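/- arXiv:1706.03134 — 2 statements merged into one kernel-verified Lean document; each statement's English description precedes it below -/
import Mathlib

section
/- For every ρ₀ ∈ (0,ρ) there exists b* > 0 such that if a = a(ε) is bounded and limsup_{ε→0} a/(ε|ln ε|²) > b*, then the zeros of the global minimizers v_{ε,a} have a limit point l with |l| ≤ ρ₀. In particular, if a is bounded and limsup_{ε→0} a/(ε|ln ε|²) = ∞, then there exists a sequence of zeros x̄_ε of v_{ε,a} with x̄_ε → 0. -/
open MeasureTheory Filter Real Set
open scoped Topology ENNReal

noncomputable section

/-- We identify the plane with the Euclidean space `ℝ²`. -/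
abbrev E2 : Type := EuclideanSpace ℝ (Fin 2)

/-- The standard basis vectors of `ℝ²`. -/
def e2basis (i : Fin 2) : E2 := EuclideanSpace.single i 1

/-- Rotation of a vector by `π/2` (multiplication by `i` in complex notation). -/
def perp (e : E2) : E2 := EuclideanSpace.single 0 (-(e 1)) + EuclideanSpace.single 1 (e 0)

/-- The unit vector `e^{iθ}`. -/
def uvec (θ : ℝ) : E2 := EuclideanSpace.single 0 (Real.cos θ) + EuclideanSpace.single 1 (Real.sin θ)

/-- The Laplacian of a map `u : ℝ² → ℝ²`. -/
def lap (u : E2 → E2) (x : E2) : E2 :=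
  ∑ i : Fin 2, fderiv ℝ (fun y => fderiv ℝ u y (e2basis i)) x (e2basis i)

/-- `|∇u|²`, the squared Hilbert-Schmidt norm of the full gradient of `u : ℝ² → ℝ²`. -/
def gradSq (u : E2 → E2) (x : E2) : ℝ := ∑ i : Fin 2, ‖fderiv ℝ u x (e2basis i)‖ ^ 2

/-- `∑_j ∇u_j · ∇ψ_j`, the Hilbert-Schmidt inner product of the gradients. -/
def gradInner (u ψ : E2 → E2) (x : E2) : ℝ :=
  ∑ i : Fin 2, (inner ℝ (fderiv ℝ u x (e2basis i)) (fderiv ℝ ψ x (e2basis i)) : ℝ)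

/-- Membership in `H¹(ℝ²,ℝ²)`: `u ∈ L²` together with its gradient. -/
def MemH1 (u : E2 → E2) : Prop :=
  Differentiable ℝ u ∧ MemLp u 2 (volume : Measure E2) ∧
    MemLp (fun x => fderiv ℝ u x) 2 (volume : Measure E2)

/-- The Ginzburg–Landau energy
`E(u) = ∫ (1/2)|∇u|² − (1/(2ε²))μ|u|² + (1/(4ε²))|u|⁴ − (a/ε) f·u`. -/
def energy (ε a : ℝ) (μ : E2 → ℝ) (f : E2 → E2) (u : E2 → E2) : ℝ :=
  ∫ x : E2, ((1/2) * gradSq u x - (1/(2*ε^2)) * μ x * ‖u x‖^2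
    + (1/(4*ε^2)) * ‖u x‖^4 - (a/ε) * (inner ℝ (f x) (u x) : ℝ))

/-- `v` is a global minimizer of `E` over `H¹(ℝ²,ℝ²)`. -/
def IsMinimizer (ε a : ℝ) (μ : E2 → ℝ) (f : E2 → E2) (v : E2 → E2) : Prop :=
  MemH1 v ∧ ∀ u : E2 → E2, MemH1 u → energy ε a μ f v ≤ energy ε a μ f u

/-- `u` is a smooth classical solution of the Euler–Lagrange equation
`ε²Δu + μu − |u|²u + εa f = 0` on `ℝ²`. -/
def IsSolution (ε a : ℝ) (μ : E2 → ℝ) (f : E2 → E2) (u : E2 → E2) : Prop :=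
  ContDiff ℝ (⊤ : ℕ∞) u ∧ ∀ x : E2, ε^2 • lap u x + μ x • u x - ‖u x‖^2 • u x + (ε*a) • f x = 0

/-- Hypotheses on the radial coefficient `μ`. -/
structure MuHyp (μ : E2 → ℝ) (μrad : ℝ → ℝ) (ρ : ℝ) : Prop where
  smooth : ContDiff ℝ (⊤ : ℕ∞) μ
  smooth_rad : ContDiff ℝ (⊤ : ℕ∞) μrad
  even_rad : ∀ r : ℝ, μrad (-r) = μrad r
  radial : ∀ x : E2, μ x = μrad ‖x‖
  bdd : ∃ C : ℝ, ∀ x : E2, |μ x| ≤ C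
  deriv_neg : ∀ r : ℝ, 0 < r → deriv μrad r < 0
  rho_pos : 0 < ρ
  rho_root : μrad ρ = 0
  rho_unique : ∀ r : ℝ, 0 < r → μrad r = 0 → r = ρ

/-- Hypotheses on the radial vector field `f`. -/
structure FHyp (f : E2 → E2) (frad : ℝ → ℝ) : Prop where
  smooth : ContDiff ℝ (⊤ : ℕ∞) f
  smooth_rad : ContDiff ℝ (⊤ : ℕ∞) frad
  odd_rad : ∀ r : ℝ, frad (-r) = -frad r
  radial : ∀ x : E2, x ≠ 0 → f x = (frad ‖x‖ / ‖x‖) • x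
  integrable : Integrable f (volume : Measure E2)
  bdd : ∃ C : ℝ, ∀ x : E2, ‖f x‖ ≤ C
  pos_rad : ∀ r : ℝ, 0 < r → 0 < frad r

/-- Convergence in `C²_loc(ℝ²,ℝ²)` of a sequence of maps. -/
def TendstoC2LocSeq (F : ℕ → E2 → E2) (g : E2 → E2) : Prop :=
  TendstoLocallyUniformly F g atTop ∧
  TendstoLocallyUniformly (fun n x => fderiv ℝ (F n) x) (fun x => fderiv ℝ g x) atTop ∧
  TendstoLocallyUniformly (fun n x => fderiv ℝ (fderiv ℝ (F n)) x)
    (fun x => fderiv ℝ (fderiv ℝ g) x) atTop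

/-- `l` is a limit point (as `ε → 0`) of the set of zeros of the family `v ε`. -/
def IsZeroLimitPoint (v : ℝ → E2 → E2) (l : E2) : Prop :=
  ∃ (εs : ℕ → ℝ) (xs : ℕ → E2), (∀ n, 0 < εs n) ∧ Tendsto εs atTop (𝓝 (0:ℝ)) ∧
    (∀ n, v (εs n) (xs n) = 0) ∧ Tendsto xs atTop (𝓝 l)


def toC (x : E2) : ℂ := (x 0 : ℂ) + (x 1 : ℂ) * Complex.I

lemma continuous_toC : Continuous toC := by
  unfold toC
  fun_prop

lemma toC_eq_zero {x : E2} (h : toC x = 0) : x = 0 := by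
  have h0 := congrArg Complex.re h
  have h1 := congrArg Complex.im h
  simp [toC] at h0 h1
  ext i; fin_cases i <;> simp [h0, h1]

lemma uvec_zero (θ : ℝ) : uvec θ 0 = Real.cos θ := by simp [uvec]
lemma uvec_one (θ : ℝ) : uvec θ 1 = Real.sin θ := by simp [uvec]

lemma norm_uvec (θ : ℝ) : ‖uvec θ‖ = 1 := by
  rw [EuclideanSpace.norm_eq]
  simp [Fin.sum_univ_two, uvec_zero, uvec_one]

lemma continuous_uvec : Continuous uvec := by
  unfold uvec
  have : ∀ i : Fin 2, Continuous fun c : ℝ => (EuclideanSpace.single i c : E2) := by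
    intro i
    have : (fun c : ℝ => (EuclideanSpace.single i c : E2)) = fun c => c • EuclideanSpace.single i 1 := by
      ext c j; simp
    rw [this]; fun_prop
  exact ((this 0).comp Real.continuous_cos).add ((this 1).comp Real.continuous_sin)

/-- a nonvanishing continuous field on the disc points inward somewhere on the circle. -/
lemma topo (v : E2 → E2) (hv : Continuous v) (r : ℝ) (hr : 0 < r)
    (hnz : ∀ x, ‖x‖ ≤ r → v x ≠ 0) :
    ∃ θ ∈ Icc (-π) π, ∃ l : ℝ, 0 < l ∧ v (r • uvec θ) = -(l • uvec θ) := by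
  by_contra! hcon
  let p : E2 → E2 := fun x => (r / max r ‖x‖) • x
  have hmax : ∀ x : E2, 0 < max r ‖x‖ := fun x => lt_max_of_lt_left hr
  have hp : Continuous p := by
    refine Continuous.smul (Continuous.div (by fun_prop) (by fun_prop) fun x => (hmax x).ne') continuous_id
  have hpn : ∀ x, ‖p x‖ ≤ r := by
    intro x
    simp only [p, norm_smul, norm_div, Real.norm_eq_abs, abs_of_pos hr, abs_of_pos (hmax x)]
    rw [div_mul_eq_mul_div, div_le_iff₀ (hmax x)]
    exact mul_le_mul_of_nonneg_left (le_max_right _ _) hr.le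
  have hpu : ∀ θ, p (r • uvec θ) = r • uvec θ := by
    intro θ
    simp only [p, norm_smul, norm_uvec, Real.norm_eq_abs, abs_of_pos hr, mul_one, max_self]
    rw [div_self hr.ne', one_smul]
  have hg0 : ∀ x, toC (v (p x)) ≠ 0 := fun x h => hnz _ (hpn x) (toC_eq_zero h)
  obtain ⟨φ, ⟨-, hφ⟩, -⟩ := Complex.isCoveringMapOn_exp.existsUnique_continuousMap_lifts
    (A := E2) ⟨fun x => toC (v (p x)), continuous_toC.comp (hv.comp hp)⟩ (a₀ := 0)
    (Complex.exp_log (hg0 0)) (fun x => hg0 x)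
  have hφ' : ∀ x, Complex.exp (φ x) = toC (v (p x)) := fun x => congrFun hφ x
  have hru : Continuous fun θ => r • uvec θ := continuous_uvec.const_smul r
  let z : ℝ → ℂ := fun θ => toC (v (r • uvec θ)) * Complex.exp (-(θ * Complex.I))
  have hz : Continuous z := by
    have := continuous_toC.comp (hv.comp hru)
    refine Continuous.mul this (by fun_prop)
  have hze : ∀ θ : ℝ, toC (v (r • uvec θ)) = z θ * Complex.exp (θ * Complex.I) := by
    intro θ
    simp only [z]; rw [mul_assoc, ← Complex.exp_add]; simp
  have hz0 : ∀ θ, z θ ≠ 0 := by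
    intro θ
    refine mul_ne_zero ?_ (Complex.exp_ne_zero _)
    have := hg0 (r • uvec θ); rwa [hpu] at this
  have hslit : ∀ θ ∈ Icc (-π) π, z θ ∈ Complex.slitPlane := by
    intro θ hθ
    by_contra hns
    rw [Complex.mem_slitPlane_iff] at hns
    push Not at hns
    obtain ⟨h1, h2⟩ := hns
    have h3 : (z θ).re ≠ 0 := fun h => hz0 θ (Complex.ext h h2)
    have h4 : 0 < -(z θ).re := by
      have := lt_of_le_of_ne h1 h3; linarith
    apply hcon θ hθ _ h4
    have hzr : z θ = ((z θ).re : ℂ) := Complex.ext (by simp) (by simp [h2])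
    have h5 := hze θ
    rw [hzr, Complex.exp_mul_I] at h5
    have h6 := congrArg Complex.re h5
    have h7 := congrArg Complex.im h5
    simp [toC, ← Complex.ofReal_cos, ← Complex.ofReal_sin] at h6 h7
    ext i; fin_cases i
    · simp [uvec_zero, h6]
    · simp [uvec_one, h7]
  let ψ : ℝ → ℂ := fun θ => φ (r • uvec θ) - Complex.log (z θ) - θ * Complex.I
  have hψ1 : ∀ θ, Complex.exp (ψ θ) = 1 := by
    intro θ
    simp only [ψ]
    rw [Complex.exp_sub, Complex.exp_sub, Complex.exp_log (hz0 θ), hφ', hpu, hze θ]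
    field_simp [hz0 θ, Complex.exp_ne_zero]
  have hψc : ContinuousOn ψ (Icc (-π) π) := by
    refine ContinuousOn.sub (ContinuousOn.sub ?_ ?_) (by fun_prop)
    · exact (φ.continuous.comp hru).continuousOn
    · exact ContinuousOn.clog hz.continuousOn hslit
  have hper : uvec π = uvec (-π) := by simp [uvec]
  have hzp : z π = z (-π) := by
    simp only [z, hper]
    congr 1
    rw [Complex.exp_neg, Complex.exp_pi_mul_I]
    simp [Complex.exp_pi_mul_I]
  have hint : ∀ θ, ∃ n : ℤ, (ψ θ).im = n * (2 * π) := by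
    intro θ
    obtain ⟨n, hn⟩ := Complex.exp_eq_one_iff.1 (hψ1 θ)
    refine ⟨n, ?_⟩
    rw [hn]; simp
  have hdiff : (ψ π).im = (ψ (-π)).im - 2 * π := by
    simp only [ψ, hzp, hper]
    simp
    ring
  have hpi := Real.pi_pos
  have hivt := intermediate_value_Icc' (a := -π) (b := π) (by linarith)
    (f := fun θ => (ψ θ).im) (Complex.continuous_im.comp_continuousOn hψc)
  have hmem : (ψ (-π)).im - π ∈ Icc ((ψ π).im) ((ψ (-π)).im) := by
    constructor <;> linarith
  obtain ⟨θ, -, hθ⟩ := hivt hmem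
  obtain ⟨n, hn⟩ := hint θ
  obtain ⟨k, hk⟩ := hint (-π)
  simp only at hθ
  rw [hn, hk] at hθ
  have : (2 * (n:ℝ)) = 2 * k - 1 := by
    have h : π * (2 * n) = π * (2 * k - 1) := by linarith
    exact mul_left_cancel₀ hpi.ne' h
  have : 2 * n = 2 * k - 1 := by exact_mod_cast this
  omega


lemma repr_polar (p : ℝ × ℝ) :
    Complex.orthonormalBasisOneI.repr (Complex.polarCoord.symm p) = p.1 • uvec p.2 := by
  rw [Complex.polarCoord_symm_apply]
  ext i; fin_cases i
  · simp [uvec_zero, ← Complex.ofReal_cos, ← Complex.ofReal_sin]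
  · simp [uvec_one, ← Complex.ofReal_cos, ← Complex.ofReal_sin]

lemma lintegral_polar (g : E2 → ℝ≥0∞) :
    ∫⁻ p in (Ioi (0:ℝ)) ×ˢ (Ioo (-π) π), ENNReal.ofReal p.1 * g (p.1 • uvec p.2) = ∫⁻ x, g x := by
  have h1 : ∫⁻ x, g x = ∫⁻ w : ℂ, g (Complex.orthonormalBasisOneI.repr w) :=
    ((Complex.orthonormalBasisOneI.measurePreserving_repr).lintegral_comp_emb
      (Complex.orthonormalBasisOneI.repr.toHomeomorph.measurableEmbedding) g).symm
  rw [h1, ← Complex.lintegral_comp_polarCoord_symm]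
  simp only [repr_polar, smul_eq_mul]
  rfl

lemma circle_exists (D : E2 → ℝ) (hDm : Measurable D) (hD0 : ∀ x, 0 ≤ D x) (hDi : Integrable D)
    (B : ℝ) (hB : ∫ x, D x ≤ B) (r1 r2 : ℝ) (h1 : 0 < r1) (h12 : r1 < r2) :
    ∃ r ∈ Ioo r1 r2, IntegrableOn (fun θ => D (r • uvec θ)) (Icc (-π) π) ∧
      ∫ θ in Icc (-π) π, D (r • uvec θ) ≤ B / (r1 * (r2 - r1)) := by
  have hm2 : Measurable fun p : ℝ × ℝ => D (p.1 • uvec p.2) :=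
    hDm.comp ((continuous_fst.smul (continuous_uvec.comp continuous_snd)).measurable)
  have hB0 : 0 ≤ B := (integral_nonneg hD0).trans hB
  let A : ℝ → ℝ≥0∞ := fun r => ∫⁻ θ in Ioo (-π) π, ENNReal.ofReal (D (r • uvec θ))
  have hAm : Measurable A := by
    exact Measurable.lintegral_prod_right' (f := fun p : ℝ × ℝ => ENNReal.ofReal (D (p.1 • uvec p.2)))
      hm2.ennreal_ofReal
  have hle : ENNReal.ofReal r1 * ∫⁻ r in Ioo r1 r2, A r ≤ ENNReal.ofReal B := by
    calc ENNReal.ofReal r1 * ∫⁻ r in Ioo r1 r2, A r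
        = ∫⁻ r in Ioo r1 r2, ENNReal.ofReal r1 * A r := by
          rw [lintegral_const_mul _ hAm]
      _ ≤ ∫⁻ r in Ioo r1 r2, ENNReal.ofReal r * A r := by
          refine setLIntegral_mono' measurableSet_Ioo fun r hr => ?_
          gcongr; exact hr.1.le
      _ = ∫⁻ r in Ioo r1 r2, ∫⁻ θ in Ioo (-π) π, ENNReal.ofReal r * ENNReal.ofReal (D (r • uvec θ)) := by
          refine lintegral_congr fun r => ?_
          rw [lintegral_const_mul]
          exact (hm2.comp measurable_prodMk_left).ennreal_ofReal
      _ = ∫⁻ p in (Ioo r1 r2) ×ˢ (Ioo (-π) π), ENNReal.ofReal p.1 * ENNReal.ofReal (D (p.1 • uvec p.2)) := by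
          rw [Measure.volume_eq_prod, ← Measure.prod_restrict, lintegral_prod]
          exact (Measurable.mul (by fun_prop) hm2.ennreal_ofReal).aemeasurable
      _ ≤ ∫⁻ p in (Ioi (0:ℝ)) ×ˢ (Ioo (-π) π), ENNReal.ofReal p.1 * ENNReal.ofReal (D (p.1 • uvec p.2)) := by
          refine lintegral_mono_set (prod_mono ?_ subset_rfl)
          intro r hr; exact h1.trans hr.1
      _ = ∫⁻ x, ENNReal.ofReal (D x) := lintegral_polar fun x => ENNReal.ofReal (D x)
      _ = ENNReal.ofReal (∫ x, D x) := (ofReal_integral_eq_lintegral_ofReal hDi (.of_forall hD0)).symm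
      _ ≤ ENNReal.ofReal B := ENNReal.ofReal_le_ofReal hB
  have hvol : volume (Ioo r1 r2) = ENNReal.ofReal (r2 - r1) := Real.volume_Ioo
  have hpos : 0 < r2 - r1 := by linarith
  obtain ⟨r, hr, hAr⟩ := exists_le_setLAverage (μ := volume) (s := Ioo r1 r2) (f := A)
    (by rw [hvol]; simpa using h12) (by rw [hvol]; simp) hAm.aemeasurable
  have hA2 : A r ≤ ENNReal.ofReal (B / (r1 * (r2 - r1))) := by
    refine hAr.trans ?_
    rw [setLAverage_eq, hvol, ENNReal.div_le_iff (by simpa using h12) (by simp),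
      ← ENNReal.ofReal_mul (by positivity)]
    have : B / (r1 * (r2 - r1)) * (r2 - r1) = B / r1 := by field_simp
    rw [this, ENNReal.ofReal_div_of_pos h1,
      ENNReal.le_div_iff_mul_le (by left; simpa using h1) (by left; simp), mul_comm]
    exact hle
  have hmr : Measurable fun θ => D (r • uvec θ) := hm2.comp measurable_prodMk_left
  have hint : IntegrableOn (fun θ => D (r • uvec θ)) (Ioo (-π) π) := by
    refine ⟨hmr.aestronglyMeasurable, ?_⟩
    rw [hasFiniteIntegral_iff_ofReal (.of_forall fun θ => hD0 _)]
    exact lt_of_le_of_lt hA2 ENNReal.ofReal_lt_top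
  refine ⟨r, hr, ?_, ?_⟩
  · rwa [integrableOn_Icc_iff_integrableOn_Ioo]
  · rw [integral_Icc_eq_integral_Ioo, integral_eq_lintegral_of_nonneg_ae (.of_forall fun θ => hD0 _) hmr.aestronglyMeasurable]
    exact ENNReal.toReal_le_of_le_ofReal (by positivity) hA2

lemma osc (z z' : ℝ → E2) (hz : ∀ θ, HasDerivAt z (z' θ) θ) (d : ℝ → ℝ) (hd0 : ∀ θ, 0 ≤ d θ)
    (hint : IntegrableOn d (Icc (-π) π)) (A : ℝ) (hA : ∫ θ in Icc (-π) π, d θ ≤ A) (k : ℝ)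
    (hk0 : 0 < k) (hk : ∀ θ, ‖z' θ‖ ^ 2 ≤ k * d θ) (η : ℝ) (hη : 0 < η) :
    ∀ s t, -π ≤ s → s ≤ t → t ≤ π → ‖z t - z s‖ ≤ (η * k * A + (t - s) / η) / 2 := by
  intro s t hs hst ht
  have hsub : Icc s t ⊆ Icc (-π) π := Icc_subset_Icc hs ht
  have hz'm : Measurable z' := by
    have : z' = deriv z := funext fun θ => (hz θ).deriv.symm
    rw [this]; exact measurable_deriv z
  have hbd : ∀ θ, ‖z' θ‖ ≤ (η * k * d θ + 1 / η) / 2 := by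
    intro θ
    have h1 : ‖z' θ‖ * 2 ≤ η * ‖z' θ‖ ^ 2 + 1 / η := by
      have : 0 ≤ (η * ‖z' θ‖ - 1) ^ 2 / η := by positivity
      have h2 : (η * ‖z' θ‖ - 1) ^ 2 / η = η * ‖z' θ‖ ^ 2 + 1 / η - ‖z' θ‖ * 2 := by
        field_simp; ring
      linarith
    have h2 := mul_le_mul_of_nonneg_left (hk θ) hη.le
    linarith
  have hdi : IntervalIntegrable d volume s t := by
    rw [intervalIntegrable_iff_integrableOn_Icc_of_le hst]
    exact hint.mono_set hsub
  have hgi : IntervalIntegrable (fun θ => (η * k * d θ + 1 / η) / 2) volume s t :=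
    ((hdi.const_mul _).add intervalIntegrable_const).div_const _
  have hz'i : IntervalIntegrable z' volume s t := by
    refine hgi.mono_fun hz'm.aestronglyMeasurable (.of_forall fun θ => ?_)
    exact (hbd θ).trans (le_abs_self _)
  rw [← intervalIntegral.integral_eq_sub_of_hasDerivAt (fun x _ => hz x) hz'i]
  refine (intervalIntegral.norm_integral_le_of_norm_le hst (.of_forall fun θ _ => hbd θ) hgi).trans ?_
  rw [intervalIntegral.integral_div, intervalIntegral.integral_add (hdi.const_mul _) intervalIntegrable_const,
    intervalIntegral.integral_const_mul, intervalIntegral.integral_const]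
  have hle : ∫ θ in s..t, d θ ≤ A := by
    rw [intervalIntegral.integral_of_le hst, ← integral_Icc_eq_integral_Ioc]
    exact (setIntegral_mono_set hint (.of_forall hd0) hsub.eventuallyLE).trans hA
  have := mul_le_mul_of_nonneg_left hle (mul_pos hη hk0).le
  rw [smul_eq_mul, mul_one_div]
  linarith


lemma hasDerivAt_uvec (θ : ℝ) :
    HasDerivAt uvec ((-Real.sin θ) • e2basis 0 + (Real.cos θ) • e2basis 1) θ := by
  have h : uvec = fun t => (Real.cos t) • e2basis 0 + (Real.sin t) • e2basis 1 := by
    ext t i; fin_cases i <;> simp [uvec, e2basis]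
  rw [h]
  exact ((Real.hasDerivAt_cos θ).smul_const _).add ((Real.hasDerivAt_sin θ).smul_const _)

lemma inner_uvec (s t : ℝ) : inner ℝ (uvec s) (uvec t) = Real.cos (t - s) := by
  rw [PiLp.inner_apply]
  simp [Fin.sum_univ_two, uvec_zero, uvec_one, Real.cos_sub]

lemma circle_deriv_bound (v : E2 → E2) (x : E2) (r θ : ℝ) :
    ‖fderiv ℝ v x (r • ((-Real.sin θ) • e2basis 0 + (Real.cos θ) • e2basis 1))‖ ^ 2
      ≤ r ^ 2 * gradSq v x := by
  rw [map_smul, map_add, map_smul, map_smul, norm_smul, mul_pow, Real.norm_eq_abs, sq_abs]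
  refine mul_le_mul_of_nonneg_left ?_ (sq_nonneg r)
  simp only [gradSq, Fin.sum_univ_two]
  set P := fderiv ℝ v x (e2basis 0)
  set Q := fderiv ℝ v x (e2basis 1)
  have h1 : ‖-Real.sin θ • P + Real.cos θ • Q‖ ≤ |Real.sin θ| * ‖P‖ + |Real.cos θ| * ‖Q‖ := by
    refine (norm_add_le _ _).trans ?_
    rw [norm_smul, norm_smul, norm_neg]; rfl
  have h2 : |Real.sin θ| ^ 2 + |Real.cos θ| ^ 2 = 1 := by
    rw [sq_abs, sq_abs]; exact Real.sin_sq_add_cos_sq θ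
  calc _ ≤ (|Real.sin θ| * ‖P‖ + |Real.cos θ| * ‖Q‖) ^ 2 := by gcongr
    _ ≤ (|Real.sin θ| ^ 2 + |Real.cos θ| ^ 2) * (‖P‖ ^ 2 + ‖Q‖ ^ 2) := by
        nlinarith [sq_nonneg (|Real.sin θ| * ‖Q‖ - |Real.cos θ| * ‖P‖)]
    _ = _ := by rw [h2, one_mul]

lemma no_zero_bound (v : E2 → E2) (hv : Differentiable ℝ v) (D : E2 → ℝ) (hDm : Measurable D)
    (hD0 : ∀ x, 0 ≤ D x) (hDi : Integrable D) (K L : ℝ) (hK : 0 < K) (hL : 1 ≤ L)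
    (hB : ∫ x, D x ≤ K * L) (ρ0 m ε c : ℝ) (hρ0 : 0 < ρ0) (hm : 0 < m)
    (hc : 0 ≤ c)
    (hKm : m ^ 2 / (128 * K) ≤ 1)
    (hgrad : ∀ x, gradSq v x ≤ 2 * D x)
    (hpot : ∀ x, ρ0 / 2 < ‖x‖ → ‖x‖ < ρ0 → ‖v x‖ ^ 2 ≤ 2 * m ^ 2 → m ^ 4 / (4 * ε ^ 2) ≤ D x)
    (hf : ∀ r θ, ρ0 / 2 < r → r < ρ0 →
      c * (‖v (r • uvec θ)‖ - inner ℝ (v (r • uvec θ)) (uvec θ)) ≤ D (r • uvec θ))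
    (hnz : ∀ x, ‖x‖ ≤ ρ0 → v x ≠ 0) :
    c * (m / 2) * (m ^ 2 / (128 * K * L)) ≤ 4 * K * L / ρ0 ^ 2 ∨
      m ^ 4 / (4 * ε ^ 2) * (m ^ 2 / (128 * K * L)) ≤ 4 * K * L / ρ0 ^ 2 := by
  have hL0 : 0 < L := by linarith
  obtain ⟨r, hr, hint, hA⟩ := circle_exists D hDm hD0 hDi (K * L) hB (ρ0 / 2) ρ0 (by positivity) (by linarith)
  have hAeq : K * L / (ρ0 / 2 * (ρ0 - ρ0 / 2)) = 4 * K * L / ρ0 ^ 2 := by field_simp; ring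
  rw [hAeq] at hA
  set A := 4 * K * L / ρ0 ^ 2 with hAdef
  have hA0 : 0 < A := by positivity
  have hr0 : 0 < r := lt_trans (by positivity) hr.1
  obtain ⟨θ0, hθ0, l, hl, hvl⟩ := topo v hv.continuous r hr0 (fun x hx => hnz x (hx.trans hr.2.le))
  set h := m ^ 2 / (128 * K * L) with hh
  have hh0 : 0 < h := by positivity
  have hh1 : h ≤ 1 := by
    refine le_trans ?_ hKm
    rw [hh]
    refine div_le_div_of_nonneg_left (by positivity) (by positivity) ?_
    exact le_mul_of_one_le_right (by positivity) hL
  set η := m / (4 * (2 * ρ0 ^ 2) * A) with hη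
  have hη0 : 0 < η := by positivity
  have hz : ∀ θ, HasDerivAt (fun θ => v (r • uvec θ)) (fderiv ℝ v (r • uvec θ)
      (r • ((-Real.sin θ) • e2basis 0 + (Real.cos θ) • e2basis 1))) θ := by
    intro θ
    exact ((hv _).hasFDerivAt).comp_hasDerivAt θ ((hasDerivAt_uvec θ).const_smul r)
  have hosc := osc _ _ hz (fun θ => D (r • uvec θ)) (fun θ => hD0 _) hint A hA (2 * ρ0 ^ 2)
    (by positivity) (by
      intro θ
      refine (circle_deriv_bound v _ r θ).trans ?_
      have h1 : r ^ 2 ≤ ρ0 ^ 2 := by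
        have := hr.2; gcongr
      calc r ^ 2 * gradSq v (r • uvec θ) ≤ r ^ 2 * (2 * D (r • uvec θ)) := by
            gcongr; exact hgrad _
        _ ≤ ρ0 ^ 2 * (2 * D (r • uvec θ)) := by
            have := hD0 (r • uvec θ); gcongr
        _ = _ := by ring) η hη0
  have hηA : η * (2 * ρ0 ^ 2) * A = m / 4 := by
    rw [hη]; field_simp
  have hhη : h / η = m / 4 := by
    rw [hη, hh, hAdef]; field_simp; norm_num
  have hpi : 3 < π := Real.pi_gt_three
  -- an interval of length `h` around `θ0`
  obtain ⟨α, hα1, hα2, hα3, hα4⟩ : ∃ α, -π ≤ α ∧ α + h ≤ π ∧ α ≤ θ0 ∧ θ0 ≤ α + h := by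
    rcases le_total θ0 0 with h0 | h0
    · exact ⟨θ0, hθ0.1, by linarith, le_rfl, by linarith⟩
    · exact ⟨θ0 - h, by linarith, by linarith [hθ0.2], by linarith, by linarith⟩
  have hclose : ∀ θ ∈ Icc α (α + h), ‖v (r • uvec θ) - v (r • uvec θ0)‖ ≤ m / 4 := by
    intro θ hθ
    rcases le_total θ0 θ with h0 | h0
    · have h1 := hosc θ0 θ hθ0.1 h0 (hθ.2.trans hα2)
      rw [hηA] at h1
      have h2 : (θ - θ0) / η ≤ h / η := by
        gcongr; linarith [hθ.2]
      rw [hhη] at h2; linarith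
    · have h1 := hosc θ θ0 (hα1.trans hθ.1) h0 hθ0.2
      rw [hηA, norm_sub_rev] at h1
      have h2 : (θ0 - θ) / η ≤ h / η := by
        gcongr; linarith [hθ.1]
      rw [hhη] at h2; linarith
  have hsub : Icc α (α + h) ⊆ Icc (-π) π := Icc_subset_Icc hα1 hα2
  have hfin : ∀ q : ℝ, (∀ θ ∈ Icc α (α + h), q ≤ D (r • uvec θ)) → q * h ≤ A := by
    intro q hq
    refine le_trans ?_ ((setIntegral_mono_set hint (.of_forall fun θ => hD0 _) hsub.eventuallyLE).trans hA)
    have h1 : ∫ θ in Icc α (α + h), q = q * h := by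
      simp [hh0.le, mul_comm]
    rw [← h1]
    exact setIntegral_mono_on (by simp) (hint.mono_set hsub) measurableSet_Icc hq
  have hnr : ∀ θ, ‖r • uvec θ‖ = r := by
    intro θ; rw [norm_smul, norm_uvec, Real.norm_eq_abs, abs_of_pos hr0, mul_one]
  have hn0 : ‖v (r • uvec θ0)‖ = l := by
    rw [hvl, norm_neg, norm_smul, norm_uvec, Real.norm_eq_abs, abs_of_pos hl, mul_one]
  rcases le_or_gt m l with hml | hml
  · left
    refine hfin _ fun θ hθ => ?_
    refine le_trans ?_ (hf r θ hr.1 hr.2)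
    refine mul_le_mul_of_nonneg_left ?_ hc
    have h1 := hclose θ hθ
    have h2 : l - m / 4 ≤ ‖v (r • uvec θ)‖ := by
      have := norm_sub_norm_le (v (r • uvec θ0)) (v (r • uvec θ))
      rw [norm_sub_rev, hn0] at this
      linarith
    have h3 : inner ℝ (v (r • uvec θ)) (uvec θ) = inner ℝ (v (r • uvec θ) - v (r • uvec θ0)) (uvec θ)
        - l * Real.cos (θ - θ0) := by
      rw [inner_sub_left, hvl, inner_neg_left, inner_smul_left, inner_uvec]; simp
    have h4 : inner ℝ (v (r • uvec θ) - v (r • uvec θ0)) (uvec θ) ≤ m / 4 := by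
      refine (real_inner_le_norm _ _).trans ?_
      rw [norm_uvec, mul_one]; exact h1
    have h5 : 0 ≤ Real.cos (θ - θ0) := by
      apply Real.cos_nonneg_of_mem_Icc
      constructor <;> linarith [hθ.1, hθ.2]
    have h6 := mul_nonneg hl.le h5
    rw [h3]
    linarith
  · right
    refine hfin _ fun θ hθ => ?_
    refine hpot _ (by rw [hnr]; exact hr.1) (by rw [hnr]; exact hr.2) ?_
    have h2 : ‖v (r • uvec θ)‖ ≤ m + m / 4 := by
      have := norm_sub_norm_le (v (r • uvec θ)) (v (r • uvec θ0))
      rw [hn0] at this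
      linarith [hclose θ hθ]
    have h3 := norm_nonneg (v (r • uvec θ))
    nlinarith


lemma mu_anti {μ : E2 → ℝ} {μrad : ℝ → ℝ} {ρ : ℝ} (hμ : MuHyp μ μrad ρ) :
    StrictAntiOn μrad (Ici 0) := by
  apply strictAntiOn_of_deriv_neg (convex_Ici 0) hμ.smooth_rad.continuous.continuousOn
  intro x hx
  rw [interior_Ici] at hx
  exact hμ.deriv_neg x hx

lemma mu_lower {μ : E2 → ℝ} {μrad : ℝ → ℝ} {ρ : ℝ} (hμ : MuHyp μ μrad ρ) :
    ∃ c : ℝ, 0 < c ∧ ∀ r ∈ Icc 0 (2 * ρ), c * |r - ρ| ≤ |μrad r| := by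
  have hρ := hμ.rho_pos
  have hanti := mu_anti hμ
  have hdiff : Differentiable ℝ μrad := hμ.smooth_rad.differentiable (by simp)
  have hcont : ContinuousOn (dslope μrad ρ) (Icc 0 (2 * ρ)) := by
    intro x _
    apply ContinuousAt.continuousWithinAt
    by_cases hx : x = ρ
    · rw [hx]; exact continuousAt_dslope_same.2 (hdiff ρ)
    · rw [continuousAt_dslope_of_ne hx]; exact hdiff.continuous.continuousAt
  obtain ⟨x0, hx0, hmax⟩ := isCompact_Icc.exists_isMaxOn (nonempty_Icc.2 (by linarith)) hcont
  have hneg : ∀ x ∈ Icc 0 (2 * ρ), dslope μrad ρ x < 0 := by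
    intro x hx
    by_cases h : x = ρ
    · rw [h, dslope_same]; exact hμ.deriv_neg ρ hρ
    · rw [dslope_of_ne _ h, slope_def_field]
      rcases lt_or_gt_of_ne h with h | h
      · have := hanti (a := x) (b := ρ) hx.1 hρ.le h
        exact div_neg_of_pos_of_neg (by linarith) (by linarith)
      · have := hanti (a := ρ) (b := x) hρ.le hx.1 h
        exact div_neg_of_neg_of_pos (by linarith) (by linarith)
  refine ⟨-dslope μrad ρ x0, by linarith [hneg x0 hx0], fun r hr => ?_⟩
  have h1 := hmax hr
  simp only [mem_ofPred_eq] at h1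
  have h2 : μrad r = (r - ρ) * dslope μrad ρ r := by
    have := sub_smul_dslope μrad ρ r
    rw [smul_eq_mul, hμ.rho_root, sub_zero] at this
    exact this.symm
  rw [h2, abs_mul, mul_comm, abs_of_neg (hneg r hr)]
  gcongr
  

lemma log_int1 (ρ c : ℝ) (hρ : 0 < ρ) (hc : 0 < c) (δ : ℝ) (hδ : 0 < δ) :
    ∫ y in (0:ℝ)..(2*ρ), 1 / (δ + c * |y - ρ|) = 2 / c * (Real.log (δ + c * ρ) - Real.log δ) := by
  have hcont : Continuous fun y : ℝ => 1 / (δ + c * |y - ρ|) :=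
    Continuous.div (by fun_prop) (by fun_prop) fun y => by positivity
  rw [← intervalIntegral.integral_add_adjacent_intervals (b := ρ) (hcont.intervalIntegrable _ _)
    (hcont.intervalIntegrable _ _)]
  have h1 : ∫ y in (0:ℝ)..ρ, 1 / (δ + c * |y - ρ|) = 1 / c * (Real.log (δ + c * ρ) - Real.log δ) := by
    rw [intervalIntegral.integral_eq_sub_of_hasDerivAt (f := fun y => -(1 / c) * Real.log (δ + c * (ρ - y)))]
    · simp; ring
    · intro x hx
      rw [uIcc_of_le hρ.le] at hx
      have hpos : 0 < δ + c * (ρ - x) := by have := mul_nonneg hc.le (sub_nonneg.2 hx.2); linarith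
      have hd : HasDerivAt (fun y => δ + c * (ρ - y)) (c * (-1)) x :=
        (((hasDerivAt_id x).const_sub ρ).const_mul c).const_add δ
      refine ((hd.log hpos.ne').const_mul (-(1 / c))).congr_deriv ?_
      rw [abs_of_nonpos (by linarith [hx.2]), neg_sub]
      field_simp
    · exact hcont.intervalIntegrable _ _
  have h2 : ∫ y in ρ..(2*ρ), 1 / (δ + c * |y - ρ|) = 1 / c * (Real.log (δ + c * ρ) - Real.log δ) := by
    rw [intervalIntegral.integral_eq_sub_of_hasDerivAt (f := fun y => (1 / c) * Real.log (δ + c * (y - ρ)))]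
    · simp; ring_nf
    · intro x hx
      rw [uIcc_of_le (by linarith)] at hx
      have hpos : 0 < δ + c * (x - ρ) := by have := mul_nonneg hc.le (sub_nonneg.2 hx.1); linarith
      have hd : HasDerivAt (fun y => δ + c * (y - ρ)) (c * 1) x :=
        (((hasDerivAt_id x).sub_const ρ).const_mul c).const_add δ
      refine ((hd.log hpos.ne').const_mul (1 / c)).congr_deriv ?_
      rw [abs_of_nonneg (by linarith [hx.1])]
      field_simp
    · exact hcont.intervalIntegrable _ _
  rw [h1, h2]; ring

lemma log_int2 (R δ : ℝ) (hδ : 0 < δ) :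
    ∫ y in (0:ℝ)..R, y / (y ^ 2 + δ) = 1 / 2 * (Real.log (R ^ 2 + δ) - Real.log δ) := by
  have hcont : Continuous fun y : ℝ => y / (y ^ 2 + δ) :=
    Continuous.div (by fun_prop) (by fun_prop) fun y => by positivity
  rw [intervalIntegral.integral_eq_sub_of_hasDerivAt (f := fun y => (1 / 2) * Real.log (y ^ 2 + δ))]
  · simp; ring
  · intro x _
    have hpos : 0 < x ^ 2 + δ := by positivity
    have hd : HasDerivAt (fun y => y ^ 2 + δ) ((2:ℕ) * x ^ (2 - 1)) x :=
      (hasDerivAt_pow 2 x).add_const δ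
    refine ((hd.log hpos.ne').const_mul (1 / 2)).congr_deriv ?_
    field_simp
    norm_num
  · exact hcont.intervalIntegrable _ _

/-- the error density -/
def qden (ρ : ℝ) (μ : E2 → ℝ) (ε : ℝ) : E2 → ℝ :=
  (Metric.ball (0 : E2) (2 * ρ)).indicator fun x => 1 + 1 / (ε ^ 2 + |μ x|) + 1 / (‖x‖ ^ 2 + ε ^ 2)

lemma qden_cont {μ : E2 → ℝ} (hμ : Continuous μ) (ε : ℝ) (hε : 0 < ε) :
    Continuous fun x : E2 => 1 + 1 / (ε ^ 2 + |μ x|) + 1 / (‖x‖ ^ 2 + ε ^ 2) := by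
  refine (continuous_const.add (Continuous.div (by fun_prop) (by fun_prop) fun y => by positivity)).add
    (Continuous.div (by fun_prop) (by fun_prop) fun y => by positivity)

lemma qden_integrable {μ : E2 → ℝ} (hμ : Continuous μ) (ρ ε : ℝ) (hε : 0 < ε) :
    Integrable (qden ρ μ ε) := by
  rw [qden, integrable_indicator_iff measurableSet_ball]
  exact ((qden_cont hμ ε hε).continuousOn.integrableOn_compact (isCompact_closedBall 0 (2 * ρ))).mono_set
    Metric.ball_subset_closedBall

lemma qden_bound {μ : E2 → ℝ} {μrad : ℝ → ℝ} {ρ : ℝ} (hμ : MuHyp μ μrad ρ) :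
    ∃ K : ℝ, 0 < K ∧ ∀ ε : ℝ, 0 < ε → ε ≤ Real.exp (-1) →
      ∫ x, qden ρ μ ε x ≤ K * (-Real.log ε) := by
  obtain ⟨c, hc, hcl⟩ := mu_lower hμ
  have hρ := hμ.rho_pos
  set V := (volume : Measure E2).real (Metric.ball 0 1) with hV
  have hV0 : 0 ≤ V := measureReal_nonneg
  set K0 := (2 * ρ) ^ 2 + 2 * ρ * (2 / c * (Real.log (1 + c * ρ) + 2)) +
    1 / 2 * (Real.log ((2 * ρ) ^ 2 + 1) + 2) with hK0
  have hl1 : 0 ≤ Real.log (1 + c * ρ) := Real.log_nonneg (by nlinarith [mul_pos hc hρ])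
  have hl2 : 0 ≤ Real.log ((2 * ρ) ^ 2 + 1) := Real.log_nonneg (by nlinarith)
  have hK0p : 0 ≤ K0 := by positivity
  refine ⟨2 * V * K0 + 1, by positivity, fun ε hε hε1 => ?_⟩
  have hε2 : ε ≤ 1 := hε1.trans (by rw [Real.exp_le_one_iff]; norm_num)
  set L := -Real.log ε with hLdef
  have hL : 1 ≤ L := by
    have := Real.log_le_log hε hε1
    rw [Real.log_exp] at this; linarith
  let q : ℝ → ℝ := (Iio (2 * ρ)).indicator fun r => 1 + 1 / (ε ^ 2 + |μrad r|) + 1 / (r ^ 2 + ε ^ 2)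
  have hq : qden ρ μ ε = fun x => q ‖x‖ := by
    ext x
    by_cases hx : ‖x‖ < 2 * ρ <;> simp [qden, q, indicator, hx, hμ.radial]
  have hcr : Continuous fun r : ℝ => r * (1 + 1 / (ε ^ 2 + |μrad r|) + 1 / (r ^ 2 + ε ^ 2)) := by
    have := hμ.smooth_rad.continuous
    refine continuous_id.mul ((continuous_const.add (Continuous.div (by fun_prop) (by fun_prop) fun y => by positivity)).add
      (Continuous.div (by fun_prop) (by fun_prop) fun y => by positivity))
  have hcb1 : Continuous fun y : ℝ => 1 / (ε ^ 2 + c * |y - ρ|) :=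
    Continuous.div (by fun_prop) (by fun_prop) fun y => by positivity
  have hcb2 : Continuous fun y : ℝ => y / (y ^ 2 + ε ^ 2) :=
    Continuous.div (by fun_prop) (by fun_prop) fun y => by positivity
  have h1 : ∫ x, qden ρ μ ε x = 2 * V *
      ∫ r in (0:ℝ)..(2*ρ), r * (1 + 1 / (ε ^ 2 + |μrad r|) + 1 / (r ^ 2 + ε ^ 2)) := by
    rw [hq, integral_fun_norm_addHaar]
    simp only [finrank_euclideanSpace, Fintype.card_fin, nsmul_eq_mul, smul_eq_mul]
    rw [← hV, intervalIntegral.integral_of_le (by positivity), integral_Ioc_eq_integral_Ioo,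
      ← Ioi_inter_Iio, ← setIntegral_indicator measurableSet_Iio]
    push_cast
    rw [mul_assoc]
    congr 3
    ext y
    by_cases hy : y < 2 * ρ <;> simp [q, indicator, hy]
  have h2 : ∫ r in (0:ℝ)..(2*ρ), r * (1 + 1 / (ε ^ 2 + |μrad r|) + 1 / (r ^ 2 + ε ^ 2)) ≤
      ∫ r in (0:ℝ)..(2*ρ), (2 * ρ + 2 * ρ * (1 / (ε ^ 2 + c * |r - ρ|)) + r / (r ^ 2 + ε ^ 2)) := by
    refine intervalIntegral.integral_mono_on (by positivity) (hcr.intervalIntegrable _ _)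
      (((continuous_const.add (continuous_const.mul hcb1)).add hcb2).intervalIntegrable _ _) ?_
    intro r hr
    have e1 := hcl r hr
    have hr0 := hr.1
    have e2 : 1 / (ε ^ 2 + |μrad r|) ≤ 1 / (ε ^ 2 + c * |r - ρ|) := by gcongr
    have e3 : r * (1 / (ε ^ 2 + |μrad r|)) ≤ 2 * ρ * (1 / (ε ^ 2 + c * |r - ρ|)) := by
      have := hr.2
      gcongr
    have e4 : r * (1 + 1 / (ε ^ 2 + |μrad r|) + 1 / (r ^ 2 + ε ^ 2)) =
      r + r * (1 / (ε ^ 2 + |μrad r|)) + r / (r ^ 2 + ε ^ 2) := by ring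
    rw [e4]
    linarith [hr.2]
  have h3 : ∫ r in (0:ℝ)..(2*ρ), (2 * ρ + 2 * ρ * (1 / (ε ^ 2 + c * |r - ρ|)) + r / (r ^ 2 + ε ^ 2))
      = (2 * ρ) ^ 2 + 2 * ρ * (2 / c * (Real.log (ε ^ 2 + c * ρ) - Real.log (ε ^ 2))) +
        1 / 2 * (Real.log ((2 * ρ) ^ 2 + ε ^ 2) - Real.log (ε ^ 2)) := by
    rw [intervalIntegral.integral_add, intervalIntegral.integral_add,
      intervalIntegral.integral_const_mul (2 * ρ) (fun r => 1 / (ε ^ 2 + c * |r - ρ|)),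
      log_int1 ρ c hρ hc _ (by positivity), log_int2 _ _ (by positivity), intervalIntegral.integral_const]
    · simp; ring
    · exact continuous_const.intervalIntegrable _ _
    · exact (continuous_const.mul hcb1).intervalIntegrable _ _
    · exact (continuous_const.add (continuous_const.mul hcb1)).intervalIntegrable _ _
    · exact hcb2.intervalIntegrable _ _
  have hεsq : ε ^ 2 ≤ 1 := by nlinarith
  have h4 : Real.log (ε ^ 2) = -2 * L := by rw [Real.log_pow, hLdef]; push_cast; ring
  have h5 : Real.log (ε ^ 2 + c * ρ) ≤ Real.log (1 + c * ρ) * L :=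
    (Real.log_le_log (by positivity) (by linarith)).trans (le_mul_of_one_le_right hl1 hL)
  have h6 : Real.log ((2 * ρ) ^ 2 + ε ^ 2) ≤ Real.log ((2 * ρ) ^ 2 + 1) * L :=
    (Real.log_le_log (by positivity) (by linarith)).trans (le_mul_of_one_le_right hl2 hL)
  have h7 : (2 * ρ) ^ 2 + 2 * ρ * (2 / c * (Real.log (ε ^ 2 + c * ρ) - Real.log (ε ^ 2))) +
        1 / 2 * (Real.log ((2 * ρ) ^ 2 + ε ^ 2) - Real.log (ε ^ 2)) ≤ K0 * L := by
    rw [h4, hK0]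
    calc _ ≤ (2 * ρ) ^ 2 * L + 2 * ρ * (2 / c * (Real.log (1 + c * ρ) * L - -2 * L)) +
        1 / 2 * (Real.log ((2 * ρ) ^ 2 + 1) * L - -2 * L) := by
          gcongr
          exact le_mul_of_one_le_right (by positivity) hL
      _ = _ := by ring
  rw [h1]
  have h8 := mul_le_mul_of_nonneg_left ((h2.trans h3.le).trans h7) (mul_nonneg zero_le_two hV0)
  nlinarith


lemma hasDerivAt_max_sq (t : ℝ) : HasDerivAt (fun t : ℝ => (max t 0) ^ 2) (2 * max t 0) t := by
  rcases lt_trichotomy t 0 with h | h | h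
  · have : (fun t : ℝ => (max t 0) ^ 2) =ᶠ[𝓝 t] fun _ => 0 := by
      filter_upwards [Iio_mem_nhds h] with y hy
      rw [max_eq_right (le_of_lt hy)]; norm_num
    rw [max_eq_right h.le, mul_zero]
    exact (hasDerivAt_const t 0).congr_of_eventuallyEq this
  · subst h
    rw [max_self, mul_zero, hasDerivAt_iff_isLittleO_nhds_zero]
    simp only [zero_add, max_self, smul_zero, sub_zero]
    have h1 : (fun h : ℝ => (max h 0) ^ 2 - 0 ^ 2) =O[𝓝 0] fun h : ℝ => h ^ 2 := by
      refine Asymptotics.IsBigO.of_bound 1 (.of_forall fun h => ?_)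
      rcases le_total h 0 with h0 | h0 <;> simp [h0, sq_nonneg]
    exact h1.trans_isLittleO (Asymptotics.isLittleO_pow_id one_lt_two)
  · have : (fun t : ℝ => (max t 0) ^ 2) =ᶠ[𝓝 t] fun t => t ^ 2 := by
      filter_upwards [Ioi_mem_nhds h] with y hy
      rw [max_eq_left (le_of_lt hy)]
    rw [max_eq_left h.le]
    have h2 := (hasDerivAt_pow 2 t).congr_of_eventuallyEq this
    simpa using h2

lemma exists_phi (ε : ℝ) (hε : 0 < ε) : ∃ φ φ' : ℝ → ℝ, (∀ t, HasDerivAt φ (φ' t) t) ∧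
    (∀ t ≤ 0, φ t = 0 ∧ φ' t = 0) ∧
    ∀ t, 0 < t → 0 ≤ φ t ∧ φ t ≤ √t ∧ √t - φ t ≤ 3 * ε ∧ φ' t ^ 2 ≤ 19 / (ε ^ 2 + t) := by
  let Q : ℝ → ℝ := fun t => (t ^ 2 + ε ^ 4) ^ (1 / 4 : ℝ)
  have hb : ∀ t : ℝ, 0 < t ^ 2 + ε ^ 4 := fun t => by positivity
  have hQ0 : ∀ t, 0 < Q t := fun t => Real.rpow_pos_of_pos (hb t) _
  have hQ4 : ∀ t, Q t ^ 4 = t ^ 2 + ε ^ 4 := by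
    intro t
    simp only [Q]
    rw [← Real.rpow_natCast, ← Real.rpow_mul (hb t).le]
    norm_num
  have hQd : ∀ t, HasDerivAt Q (t / (2 * Q t ^ 3)) t := by
    intro t
    have h1 : HasDerivAt (fun t : ℝ => t ^ 2 + ε ^ 4) ((2:ℕ) * t ^ (2 - 1)) t :=
      (hasDerivAt_pow 2 t).add_const _
    refine (h1.rpow_const (p := 1 / 4) (Or.inl (hb t).ne')).congr_deriv ?_
    have h2 : (t ^ 2 + ε ^ 4) ^ ((1:ℝ) / 4 - 1) = Q t / Q t ^ 4 := by
      rw [Real.rpow_sub_one (hb t).ne', hQ4]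
    rw [h2]
    have := hQ0 t
    field_simp
    norm_num
    ring
  refine ⟨fun t => (max t 0) ^ 2 / Q t ^ 3,
    fun t => (2 * max t 0 * Q t ^ 3 - (max t 0) ^ 2 * ((3:ℕ) * Q t ^ (3 - 1) * (t / (2 * Q t ^ 3)))) / (Q t ^ 3) ^ 2,
    fun t => ?_, fun t ht => ?_, fun t ht => ?_⟩
  · exact (hasDerivAt_max_sq t).div ((hQd t).pow 3) (pow_pos (hQ0 t) 3).ne'
  · simp [max_eq_right ht]
  · simp only [max_eq_left ht.le]
    have hq := hQ0 t
    have hq4 := hQ4 t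
    set q := Q t
    obtain ⟨p, hp0, hpt⟩ : ∃ p : ℝ, 0 < p ∧ t = p ^ 2 := ⟨√t, Real.sqrt_pos.2 ht, (Real.sq_sqrt ht.le).symm⟩
    have hsq : √t = p := by rw [hpt, Real.sqrt_sq hp0.le]
    rw [hsq]
    subst hpt
    have hpq : p ≤ q := by
      refine le_of_pow_le_pow_left₀ (n := 4) (by norm_num) hq.le ?_
      rw [hq4]; nlinarith [pow_pos hε 4]
    have hqp : q ≤ p + ε := by
      refine le_of_pow_le_pow_left₀ (n := 4) (by norm_num) (by positivity) ?_
      rw [hq4]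
      have : (p + ε) ^ 4 = (p ^ 2) ^ 2 + ε ^ 4 + (4 * p ^ 3 * ε + 6 * p ^ 2 * ε ^ 2 + 4 * p * ε ^ 3) := by ring
      rw [this]
      have : 0 < 4 * p ^ 3 * ε + 6 * p ^ 2 * ε ^ 2 + 4 * p * ε ^ 3 := by positivity
      linarith
    have hp3 : p ^ 3 ≤ q ^ 3 := by gcongr
    refine ⟨by positivity, ?_, ?_, ?_⟩
    · rw [div_le_iff₀ (by positivity)]
      calc (p ^ 2) ^ 2 = p * p ^ 3 := by ring
        _ ≤ p * q ^ 3 := by gcongr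
    · rw [sub_le_iff_le_add, ← sub_le_iff_le_add', le_div_iff₀ (by positivity)]
      have h1 : q ^ 3 - p ^ 3 ≤ ε * (3 * q ^ 2) := by
        have : q ^ 3 - p ^ 3 = (q - p) * (q ^ 2 + q * p + p ^ 2) := by ring
        rw [this]
        have h2 : q ^ 2 + q * p + p ^ 2 ≤ 3 * q ^ 2 := by nlinarith
        exact mul_le_mul (by linarith) h2 (by positivity) hε.le
      have h3 : p * (q ^ 3 - p ^ 3) ≤ q * (ε * (3 * q ^ 2)) :=
        mul_le_mul hpq h1 (by linarith) hq.le
      nlinarith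
    · have h1 : (2 * p ^ 2 * q ^ 3 - (p ^ 2) ^ 2 * ((3:ℕ) * q ^ (3 - 1) * (p ^ 2 / (2 * q ^ 3)))) / (q ^ 3) ^ 2
          = (2 * (p / q) ^ 2 - 3 / 2 * (p / q) ^ 6) / q := by
        field_simp
        norm_num
        ring
      rw [h1]
      have hx0 : 0 ≤ p / q := by positivity
      have hx1 : p / q ≤ 1 := by rw [div_le_one hq]; exact hpq
      set x := p / q
      have hx2 : x ^ 2 ≤ 1 := by nlinarith
      have hx6 : x ^ 6 ≤ 1 := pow_le_one₀ hx0 hx1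
      have hx6' : 0 ≤ x ^ 6 := by positivity
      have h2 : (2 * x ^ 2 - 3 / 2 * x ^ 6) ^ 2 ≤ 4 := by
        have h5 : -2 ≤ 2 * x ^ 2 - 3 / 2 * x ^ 6 := by nlinarith [sq_nonneg x]
        have h6 : 2 * x ^ 2 - 3 / 2 * x ^ 6 ≤ 2 := by nlinarith [sq_nonneg x]
        nlinarith
      have h3 : ε ^ 2 + p ^ 2 ≤ 2 * q ^ 2 := by
        refine le_of_pow_le_pow_left₀ (n := 2) (by norm_num) (by positivity) ?_
        nlinarith [sq_nonneg (ε ^ 2 - p ^ 2)]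
      rw [div_pow, div_le_div_iff₀ (by positivity) (by positivity)]
      nlinarith [sq_nonneg q]


def eden (ε a : ℝ) (μ : E2 → ℝ) (f : E2 → E2) (u : E2 → E2) (x : E2) : ℝ :=
  (1/2) * gradSq u x - (1/(2*ε^2)) * μ x * ‖u x‖^2
    + (1/(4*ε^2)) * ‖u x‖^4 - (a/ε) * (inner ℝ (f x) (u x) : ℝ)

lemma energy_eq (ε a : ℝ) (μ : E2 → ℝ) (f : E2 → E2) (u : E2 → E2) :
    energy ε a μ f u = ∫ x, eden ε a μ f u x := rfl

def Tden (ε a : ℝ) (μ : E2 → ℝ) (f : E2 → E2) (x : E2) : ℝ :=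
  (max (μ x) 0)^2/(4*ε^2) + (a/ε)*‖f x‖*√(max (μ x) 0)

lemma gradSq_le (u : E2 → E2) (x : E2) : gradSq u x ≤ 2 * ‖fderiv ℝ u x‖ ^ 2 := by
  have h : ∀ i, ‖fderiv ℝ u x (e2basis i)‖ ^ 2 ≤ ‖fderiv ℝ u x‖ ^ 2 := by
    intro i
    have := (fderiv ℝ u x).le_opNorm (e2basis i)
    have h1 : ‖e2basis i‖ = 1 := by simp [e2basis]
    rw [h1, mul_one] at this
    gcongr
  simp only [gradSq, Fin.sum_univ_two]
  linarith [h 0, h 1]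

lemma gradSq_nonneg (u : E2 → E2) (x : E2) : 0 ≤ gradSq u x := by
  simp only [gradSq]; positivity

lemma measurable_gradSq (u : E2 → E2) : Measurable (gradSq u) := by
  unfold gradSq
  refine Finset.measurable_sum _ fun i _ => ?_
  exact (measurable_fderiv_apply_const ℝ u (e2basis i)).norm.pow_const 2

lemma wmap (ε : ℝ) (hε : 0 < ε) (x : E2) : ∃ W : E2 →L[ℝ] E2,
    HasFDerivAt (fun y : E2 => (√(‖y‖^2+ε^2))⁻¹ • y) W x ∧ ‖W‖ ≤ 2/√(‖x‖^2+ε^2) := by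
  have hp : 0 < ‖x‖^2+ε^2 := by positivity
  have hs : 0 < √(‖x‖^2+ε^2) := Real.sqrt_pos.2 hp
  have h1 : HasFDerivAt (fun y : E2 => ‖y‖^2+ε^2) (2 • (innerSL ℝ x)) x :=
    ((hasStrictFDerivAt_norm_sq x).hasFDerivAt).add_const _
  have h2 := h1.sqrt hp.ne'
  have h3 := (hasDerivAt_inv hs.ne').comp_hasFDerivAt x h2
  have h4 := h3.smul (hasFDerivAt_id x)
  refine ⟨_, h4, ?_⟩
  refine ContinuousLinearMap.opNorm_le_bound _ (by positivity) fun h => ?_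
  have hss : √(‖x‖^2+ε^2)^2 = ‖x‖^2+ε^2 := Real.sq_sqrt hp.le
  simp only [Function.comp, ContinuousLinearMap.add_apply, ContinuousLinearMap.smul_apply,
    ContinuousLinearMap.smulRight_apply, ContinuousLinearMap.id_apply, id, innerSL_apply_apply]
  set s := √(‖x‖^2+ε^2)
  refine (norm_add_le _ _).trans ?_
  rw [norm_smul, norm_smul]
  have hi : |(inner ℝ x h : ℝ)| ≤ ‖x‖ * ‖h‖ := abs_real_inner_le_norm x h
  have e1 : ‖s⁻¹‖ * ‖h‖ = (1 / s) * ‖h‖ := by rw [Real.norm_of_nonneg (by positivity)]; ring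
  have e2 : ‖-(s ^ 2)⁻¹ • (1 / (2 * s)) • 2 • (inner ℝ x h : ℝ)‖ = |(inner ℝ x h : ℝ)| / s ^ 3 := by
    have : -(s ^ 2)⁻¹ • (1 / (2 * s)) • 2 • (inner ℝ x h : ℝ) = - ((inner ℝ x h : ℝ) / s ^ 3) := by
      simp only [smul_eq_mul, nsmul_eq_mul]
      field_simp
      norm_num
    rw [this, norm_neg, Real.norm_eq_abs, abs_div, abs_of_pos (pow_pos hs 3)]
  have e3 : |(inner ℝ x h : ℝ)| / s ^ 3 * ‖x‖ ≤ (1 / s) * ‖h‖ := by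
    rw [div_mul_eq_mul_div, div_le_iff₀ (by positivity)]
    have : 1 / s * ‖h‖ * s ^ 3 = s ^ 2 * ‖h‖ := by field_simp
    rw [this, hss]
    calc |(inner ℝ x h : ℝ)| * ‖x‖ ≤ ‖x‖ * ‖h‖ * ‖x‖ := by gcongr
      _ ≤ (‖x‖^2+ε^2) * ‖h‖ := by nlinarith [norm_nonneg h, sq_nonneg ε, mul_nonneg (sq_nonneg ε) (norm_nonneg h)]
  calc _ ≤ (1 / s) * ‖h‖ + (1 / s) * ‖h‖ := by
        refine add_le_add e1.le ?_
        refine le_trans (le_of_eq ?_) e3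
        rw [← e2]
    _ = 2 / s * ‖h‖ := by ring

lemma scal (ε a C t M F Mf p φ r s : ℝ) (hε : 0 < ε) (ha : 0 < a) (haC : a ≤ C)
    (htM : t ≤ M) (hp : 0 ≤ p) (hpt : p^2 = t) (hF : 0 ≤ F) (hFM : F ≤ Mf)
    (hφ0 : 0 ≤ φ) (hφp : φ ≤ p) (hφe : p - φ ≤ 3*ε) (hr : 0 ≤ r) (hs : 0 < s) (hrs : r ≤ s)
    (hsr : s ≤ r + ε) :
    - (1/(2*ε^2)) * t * (φ*(r/s))^2 + (1/(4*ε^2)) * (φ*(r/s))^4 - (a/ε)*(F*(φ*(r/s)))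
      + (t^2/(4*ε^2) + (a/ε)*F*p) ≤ (18*M + C*Mf*(4+M)) + (2*M^2 + C*Mf*(1+M)) / s^2 := by
  have hM : 0 ≤ M := le_trans (by rw [← hpt]; positivity) htM
  have hC : 0 < C := ha.trans_le haC
  have hMf : 0 ≤ Mf := hF.trans hFM
  set U := φ*(r/s) with hU
  have hrs1 : r/s ≤ 1 := by rw [div_le_one hs]; exact hrs
  have hrs0 : 0 ≤ r/s := by positivity
  have hU0 : 0 ≤ U := by positivity
  have hUφ : U ≤ φ := by rw [hU]; nlinarith
  have hUp : U ≤ p := hUφ.trans hφp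
  have hd : p - U ≤ ε * (3 + p / s) := by
    have h1 : φ - U ≤ p * (ε / s) := by
      have : φ - U = φ * ((s - r)/s) := by rw [hU]; field_simp
      rw [this]
      have : (s - r)/s ≤ ε/s := by gcongr; linarith
      exact mul_le_mul hφp this (div_nonneg (by linarith) hs.le) hp
    have : ε * (3 + p / s) = 3*ε + p * (ε / s) := by ring
    linarith
  have hps : 0 ≤ p/s := by positivity
  have eq1 : - (1/(2*ε^2)) * t * U^2 + (1/(4*ε^2)) * U^4 - (a/ε)*(F*U)
      + (t^2/(4*ε^2) + (a/ε)*F*p) = (1/(4*ε^2)) * ((p-U)*(p+U))^2 + (a/ε)*F*(p-U) := by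
    rw [← hpt]; field_simp; ring
  rw [eq1]
  have b1 : (1/(4*ε^2)) * ((p-U)*(p+U))^2 ≤ 18*M + 2*M^2/s^2 := by
    have h1 : (p-U)*(p+U) ≤ (ε * (3 + p / s)) * (2*p) :=
      mul_le_mul hd (by linarith) (by linarith) (by positivity)
    have h2 : ((p-U)*(p+U))^2 ≤ ((ε * (3 + p / s)) * (2*p))^2 := by
      have : 0 ≤ (p-U)*(p+U) := mul_nonneg (by linarith) (by linarith)
      gcongr
    have h3 : (1/(4*ε^2)) * ((ε * (3 + p / s)) * (2*p))^2 = (3+p/s)^2 * t := by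
      rw [← hpt]; field_simp; ring
    have h4 : (3+p/s)^2 ≤ 18 + 2*M/s^2 := by
      have : 2*(p/s)^2 ≤ 2*M/s^2 := by
        rw [div_pow, hpt, mul_div_assoc]; gcongr
      nlinarith [sq_nonneg (3-p/s)]
    calc _ ≤ (1/(4*ε^2)) * ((ε * (3 + p / s)) * (2*p))^2 := by gcongr
      _ = (3+p/s)^2 * t := h3
      _ ≤ (18 + 2*M/s^2) * M := by
        refine mul_le_mul h4 htM ?_ (by positivity)
        rw [← hpt]; positivity
      _ = _ := by ring
  have b2 : (a/ε)*F*(p-U) ≤ C*Mf*(4+M) + C*Mf*(1+M)/s^2 := by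
    have h1 : (a/ε)*F*(p-U) ≤ (a/ε)*F*(ε * (3 + p / s)) := by gcongr
    have h2 : (a/ε)*F*(ε * (3 + p / s)) = a*F*(3+p/s) := by field_simp
    have h3 : p/s ≤ (1+M)*(1+1/s^2) := by
      have i1 : p ≤ 1 + M := by nlinarith [sq_nonneg (p-1)]
      have i2 : 1/s ≤ 1+1/s^2 := by
        have : 1/s^2 = (1/s)^2 := by rw [div_pow, one_pow]
        rw [this]; nlinarith [sq_nonneg (1/s-1)]
      rw [div_eq_mul_one_div]
      exact mul_le_mul i1 i2 (by positivity) (by positivity)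
    calc _ ≤ a*F*(3+p/s) := by rw [← h2]; exact h1
      _ ≤ C*Mf*(3+(1+M)*(1+1/s^2)) := by gcongr
      _ = _ := by ring
  have : (18*M + C*Mf*(4+M)) + (2*M^2 + C*Mf*(1+M)) / s^2 = 18*M + 2*M^2/s^2 + (C*Mf*(4+M) + C*Mf*(1+M)/s^2) := by ring
  rw [this]
  exact add_le_add b1 b2


lemma mu_pos_iff {μ : E2 → ℝ} {μrad : ℝ → ℝ} {ρ : ℝ} (hμ : MuHyp μ μrad ρ) (x : E2) :
    0 < μ x ↔ ‖x‖ < ρ := by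
  rw [hμ.radial, ← hμ.rho_root]
  exact (mu_anti hμ).lt_iff_gt (mem_Ici.2 hμ.rho_pos.le) (mem_Ici.2 (norm_nonneg x))

lemma test_exists {μ : E2 → ℝ} {μrad : ℝ → ℝ} {ρ : ℝ} {f : E2 → E2} {frad : ℝ → ℝ}
    (hμ : MuHyp μ μrad ρ) (hf : FHyp f frad) (C : ℝ) (hC : 0 < C) :
    ∃ K1 : ℝ, 0 < K1 ∧ ∀ ε, 0 < ε → ε ≤ 1 → ∀ a, 0 < a → a ≤ C → ∃ u : E2 → E2,
      MemH1 u ∧ Integrable (eden ε a μ f u) ∧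
      ∀ x, eden ε a μ f u x + Tden ε a μ f x ≤ K1 * qden ρ μ ε x := by
  obtain ⟨M, hM⟩ := hμ.bdd
  obtain ⟨Mf, hMf⟩ := hf.bdd
  have hM0 : 0 ≤ M := (abs_nonneg _).trans (hM 0)
  have hMf0 : 0 ≤ Mf := (norm_nonneg _).trans (hMf 0)
  have hμd : Differentiable ℝ μ := hμ.smooth.differentiable (by simp)
  have hμc : Continuous μ := hμd.continuous
  have hμdc : Continuous (fderiv ℝ μ) := hμ.smooth.continuous_fderiv (by simp)
  obtain ⟨M1, hM1⟩ := (isCompact_closedBall (0:E2) (2*ρ)).exists_bound_of_continuousOn hμdc.continuousOn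
  have hρ := hμ.rho_pos
  have hM10 : 0 ≤ M1 := (norm_nonneg _).trans (hM1 0 (by simp [hρ.le]))
  refine ⟨1 + 38*M1^2 + (18*M + C*Mf*(4+M)) + (8*M + 2*M^2 + C*Mf*(1+M)), by positivity, ?_⟩
  intro ε hε hε1 a ha haC
  obtain ⟨φ, φ', hφd, hφn, hφp⟩ := exists_phi ε hε
  let s : E2 → ℝ := fun y => √(‖y‖^2+ε^2)
  have hs0 : ∀ y, 0 < s y := fun y => Real.sqrt_pos.2 (by positivity)
  have hs2 : ∀ y, s y ^ 2 = ‖y‖^2+ε^2 := fun y => Real.sq_sqrt (by positivity)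
  have hrs : ∀ y, ‖y‖ ≤ s y := fun y => Real.le_sqrt_of_sq_le (by nlinarith [sq_nonneg ε])
  have hsr : ∀ y, s y ≤ ‖y‖ + ε := fun y =>
    Real.sqrt_le_iff.2 ⟨by positivity, by nlinarith [norm_nonneg y]⟩
  choose W hW hWn using wmap ε hε
  let w : E2 → E2 := fun y => (√(‖y‖^2+ε^2))⁻¹ • y
  have hwn : ∀ y, ‖w y‖ = ‖y‖ / s y := by
    intro y
    simp only [w]
    rw [norm_smul, norm_inv, Real.norm_of_nonneg (hs0 y).le]
    rw [div_eq_inv_mul]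
  have hwn1 : ∀ y, ‖w y‖ ≤ 1 := fun y => by rw [hwn, div_le_one (hs0 y)]; exact hrs y
  let u : E2 → E2 := fun y => φ (μ y) • w y
  have hud : ∀ x, HasFDerivAt u (φ (μ x) • W x + (φ' (μ x) • fderiv ℝ μ x).smulRight (w x)) x := by
    intro x
    exact ((hφd (μ x)).comp_hasFDerivAt x (hμd x).hasFDerivAt).smul (hW x)
  have hun : ∀ x, ρ ≤ ‖x‖ → u x = 0 ∧ fderiv ℝ u x = 0 := by
    intro x hx
    have h0 : μ x ≤ 0 := by
      by_contra h; push Not at h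
      exact absurd ((mu_pos_iff hμ x).1 h) (by linarith)
    obtain ⟨e1, e2⟩ := hφn _ h0
    refine ⟨by simp [u, e1], ?_⟩
    rw [(hud x).fderiv, e1, e2]; ext; simp
  have hφ0 : ∀ t, 0 ≤ φ t := fun t => by
    rcases le_or_gt t 0 with h | h
    · rw [(hφn t h).1]
    · exact (hφp t h).1
  have hunorm : ∀ x, ‖u x‖ = φ (μ x) * (‖x‖ / s x) := by
    intro x
    simp only [u]
    rw [norm_smul, hwn, Real.norm_of_nonneg (hφ0 _)]
  have hder : ∀ x, ‖x‖ < ρ → ‖fderiv ℝ u x‖^2 ≤ 8*M/(s x)^2 + 38*M1^2/(ε^2+μ x) := by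
    intro x hx
    have ht := (mu_pos_iff hμ x).2 hx
    obtain ⟨p1, p2, p3, p4⟩ := hφp _ ht
    have n1 : ‖fderiv ℝ u x‖ ≤ φ (μ x) * (2 / s x) + |φ' (μ x)| * M1 := by
      rw [(hud x).fderiv]
      refine (norm_add_le _ _).trans (add_le_add ?_ ?_)
      · rw [norm_smul, Real.norm_of_nonneg p1]; gcongr; exact hWn x
      · rw [ContinuousLinearMap.norm_smulRight_apply, norm_smul, Real.norm_eq_abs]
        have := hM1 x (by simp; linarith)
        calc _ ≤ |φ' (μ x)| * M1 * 1 := by gcongr; exact hwn1 x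
          _ = _ := mul_one _
    have n2 : (φ (μ x) * (2 / s x))^2 ≤ 4*M/(s x)^2 := by
      have : φ (μ x)^2 ≤ M := by
        calc φ (μ x)^2 ≤ √(μ x)^2 := by gcongr
          _ = μ x := Real.sq_sqrt ht.le
          _ ≤ M := (le_abs_self _).trans (hM x)
      calc _ = φ (μ x)^2 * 4 / (s x)^2 := by ring
        _ ≤ M * 4 / (s x)^2 := by gcongr
        _ = _ := by ring
    have n3 : (|φ' (μ x)| * M1)^2 ≤ 19*M1^2/(ε^2+μ x) := by
      rw [mul_pow, sq_abs]
      calc _ ≤ 19/(ε^2+μ x) * M1^2 := by gcongr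
        _ = _ := by ring
    calc ‖fderiv ℝ u x‖^2 ≤ (φ (μ x) * (2 / s x) + |φ' (μ x)| * M1)^2 := by gcongr
      _ ≤ 2*(φ (μ x) * (2 / s x))^2 + 2*(|φ' (μ x)| * M1)^2 := by
        nlinarith [sq_nonneg (φ (μ x) * (2 / s x) - |φ' (μ x)| * M1)]
      _ ≤ 2*(4*M/(s x)^2) + 2*(19*M1^2/(ε^2+μ x)) := by gcongr
      _ = _ := by ring
  have hudiff : Differentiable ℝ u := fun x => (hud x).differentiableAt
  have huc : Continuous u := hudiff.continuous
  have husupp : HasCompactSupport u := by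
    refine HasCompactSupport.intro (isCompact_closedBall (0:E2) ρ) fun x hx => ?_
    simp at hx
    exact (hun x hx.le).1
  have hgi : Integrable (fun x => ‖fderiv ℝ u x‖^2) := by
    have hi : Integrable ((Metric.closedBall (0:E2) ρ).indicator fun _ => 8*M/ε^2 + 38*M1^2/ε^2) :=
      (integrable_indicator_iff measurableSet_closedBall).2
        (integrableOn_const (isCompact_closedBall _ _).measure_lt_top.ne)
    refine hi.mono' ((measurable_fderiv ℝ u).norm.pow_const 2).aestronglyMeasurable (.of_forall fun x => ?_)
    rw [Real.norm_of_nonneg (by positivity)]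
    by_cases hx : ‖x‖ < ρ
    · rw [indicator_of_mem (by simp [hx.le])]
      refine (hder x hx).trans ?_
      have := (mu_pos_iff hμ x).2 hx
      rw [hs2]
      gcongr
      · nlinarith [sq_nonneg ‖x‖]
      · linarith
    · push Not at hx
      rw [(hun x hx).2, norm_zero]
      norm_num
      exact indicator_nonneg (fun _ _ => by positivity) _
  refine ⟨u, ⟨hudiff, huc.memLp_of_hasCompactSupport husupp, ?_⟩, ?_, ?_⟩
  · exact (memLp_two_iff_integrable_sq_norm (measurable_fderiv ℝ u).aestronglyMeasurable).2 hgi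
  · have i1 : Integrable (gradSq u) := by
      refine (hgi.const_mul 2).mono' (measurable_gradSq u).aestronglyMeasurable (.of_forall fun x => ?_)
      rw [Real.norm_of_nonneg (gradSq_nonneg u x)]
      exact gradSq_le u x
    have i2 : Integrable (fun x => - (1/(2*ε^2)) * μ x * ‖u x‖^2
        + (1/(4*ε^2)) * ‖u x‖^4 - (a/ε) * (inner ℝ (f x) (u x) : ℝ)) := by
      have hfc := hf.smooth.continuous
      refine Continuous.integrable_of_hasCompactSupport (by fun_prop) ?_
      refine HasCompactSupport.intro husupp fun x hx => ?_
      have : u x = 0 := image_eq_zero_of_notMem_tsupport hx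
      simp [this]
    refine ((i1.const_mul (1/2)).add i2).congr (.of_forall fun x => ?_)
    simp only [eden, Pi.add_apply]; ring
  · intro x
    by_cases hx : ‖x‖ < ρ
    · have ht := (mu_pos_iff hμ x).2 hx
      obtain ⟨p1, p2, p3, p4⟩ := hφp _ ht
      have hin : (inner ℝ (f x) (u x) : ℝ) = ‖f x‖ * (φ (μ x) * (‖x‖ / s x)) := by
        by_cases hx0 : x = 0
        · subst hx0; simp [u, w]
        · have hxn : 0 < ‖x‖ := norm_pos_iff.2 hx0
          have hfp := hf.pos_rad _ hxn
          rw [hf.radial x hx0]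
          simp only [u, w]
          rw [inner_smul_left, inner_smul_right, inner_smul_right, real_inner_self_eq_norm_sq, norm_smul,
            Real.norm_of_nonneg (by positivity)]
          simp only [s, conj_trivial]
          field_simp
      have hsc := scal ε a C (μ x) M ‖f x‖ Mf (√(μ x)) (φ (μ x)) ‖x‖ (s x) hε ha haC
        ((le_abs_self _).trans (hM x)) (Real.sqrt_nonneg _) (Real.sq_sqrt ht.le) (norm_nonneg _) (hMf x)
        p1 p2 p3 (norm_nonneg _) (hs0 x) (hrs x) (hsr x)
      have hg := (gradSq_le u x).trans (mul_le_mul_of_nonneg_left (hder x hx) (by norm_num : (0:ℝ) ≤ 2))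
      have hq : qden ρ μ ε x = 1 + 1/(ε^2+μ x) + 1/(s x)^2 := by
        rw [qden, indicator_of_mem (by simp; linarith), abs_of_pos ht, hs2]
      rw [hq]
      simp only [eden, Tden, max_eq_left ht.le]
      rw [hin, hunorm]
      have hA : 0 < 1/(ε^2+μ x) := by positivity
      have hB : 0 < 1/(s x)^2 := by have := hs0 x; positivity
      have r1 : 8*M/(s x)^2 = 8*M*(1/(s x)^2) := by ring
      have r2 : 38*M1^2/(ε^2+μ x) = 38*M1^2*(1/(ε^2+μ x)) := by ring
      have r3 : (2*M^2 + C*Mf*(1+M)) / (s x)^2 = (2*M^2 + C*Mf*(1+M)) * (1/(s x)^2) := by ring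
      rw [r1, r2] at hg
      rw [r3] at hsc
      have c1 : 0 ≤ 38*M1^2 := by positivity
      have c2 : 0 ≤ 18*M + C*Mf*(4+M) := by positivity
      have c3 : 0 ≤ 8*M + 2*M^2 + C*Mf*(1+M) := by positivity
      generalize 1/(s x)^2 = B at *
      generalize 1/(ε^2+μ x) = A at *
      have key : 38*M1^2*A + (18*M + C*Mf*(4+M)) + (8*M + 2*M^2 + C*Mf*(1+M))*B ≤
          (1 + 38*M1^2 + (18*M + C*Mf*(4+M)) + (8*M + 2*M^2 + C*Mf*(1+M))) * (1 + A + B) := by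
        generalize 38*M1^2 = X at *
        generalize 18*M + C*Mf*(4+M) = Y at *
        generalize 8*M + 2*M^2 + C*Mf*(1+M) = Z at *
        nlinarith [mul_nonneg c1 hA.le, mul_nonneg c1 hB.le, mul_nonneg c2 hA.le, mul_nonneg c2 hB.le,
          mul_nonneg c3 hA.le, mul_nonneg c3 hB.le]
      linarith
    · push Not at hx
      have h0 : μ x ≤ 0 := by
        by_contra h; push Not at h
        exact absurd ((mu_pos_iff hμ x).1 h) (by linarith)
      obtain ⟨e1, e2⟩ := hun x hx
      have hg : gradSq u x = 0 := by simp [gradSq, e2]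
      have : eden ε a μ f u x + Tden ε a μ f x = 0 := by
        simp [eden, Tden, hg, e1, max_eq_right h0]
      rw [this]
      refine mul_nonneg (by positivity) ?_
      exact indicator_nonneg (fun _ _ => by positivity) _


def Dden (ε a : ℝ) (μ : E2 → ℝ) (f v : E2 → E2) (x : E2) : ℝ :=
  (1/2) * gradSq v x + (1/(16*ε^2)) * (‖v x‖^2 - max (μ x) 0)^2
    + (a/ε) * (‖f x‖ * ‖v x‖ - (inner ℝ (f x) (v x) : ℝ))

lemma Dden_nonneg (ε a : ℝ) (hε : 0 < ε) (ha : 0 < a) (μ : E2 → ℝ) (f v : E2 → E2) (x : E2) :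
    0 ≤ Dden ε a μ f v x := by
  have h1 := gradSq_nonneg v x
  have h2 : 0 ≤ ‖f x‖ * ‖v x‖ - (inner ℝ (f x) (v x) : ℝ) := by linarith [real_inner_le_norm (f x) (v x)]
  unfold Dden; positivity

lemma quad_low (A B σ : ℝ) (hA : 0 < A) : - (B^2/(4*A)) ≤ A*σ^2 - B*σ := by
  have : A*σ^2 - B*σ + B^2/(4*A) = A * (σ - B/(2*A))^2 := by field_simp; ring
  have h2 : 0 ≤ A * (σ - B/(2*A))^2 := by positivity
  linarith

lemma low_split (ε V p n : ℝ) (hε : 0 < ε)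
    (hp : 0 ≤ p) (hn : 0 ≤ n) (hσ : 0 ≤ V - p) :
    (3/(16*ε^2))*((V-p)^4 + (V-p)^2*(p^2+n)) ≤ (3/(16*ε^2))*(V^2-p^2)^2 + n*V^2/(2*ε^2) := by
  obtain ⟨σ, hs⟩ : ∃ σ, σ = V - p := ⟨_, rfl⟩
  rw [← hs] at hσ ⊢
  have hV : V = σ + p := by linarith
  subst hV
  have : (3/(16*ε^2))*((σ+p)^2-p^2)^2 + n*(σ+p)^2/(2*ε^2) - (3/(16*ε^2))*(σ^4 + σ^2*(p^2+n))
    = (1/(16*ε^2)) * (3*(4*σ^3*p+3*σ^2*p^2) + n*(5*σ^2+16*σ*p+8*p^2)) := by field_simp; ring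
  have h2 : 0 ≤ (1/(16*ε^2)) * (3*(4*σ^3*p+3*σ^2*p^2) + n*(5*σ^2+16*σ*p+8*p^2)) := by positivity
  linarith

lemma low1 (ε a F V p n : ℝ) (hε : 0 < ε) (hε1 : ε ≤ 1) (ha : 0 < a) (hF : 0 ≤ F)
    (hV : 0 ≤ V) (hp : 0 ≤ p) (hn : 0 ≤ n) :
    -1 - 2*a^2*F^2*(1/(ε^2+(p^2+n))) ≤ (3/(16*ε^2))*(V^2-p^2)^2 + n*V^2/(2*ε^2) - (a/ε)*F*(V-p) := by
  have hX : 0 ≤ 2*a^2*F^2*(1/(ε^2+(p^2+n))) := by positivity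
  rcases le_total (V-p) 0 with h | h
  · have h1 : 0 ≤ (3/(16*ε^2))*(V^2-p^2)^2 + n*V^2/(2*ε^2) := by positivity
    have h2 : (a/ε)*F*(V-p) ≤ 0 := mul_nonpos_of_nonneg_of_nonpos (by positivity) h
    linarith
  · have h1 := low_split ε V p n hε hp hn h
    generalize V - p = σ at *
    have hT : 0 ≤ p^2+n := by positivity
    generalize p^2+n = T at *
    have h2 : (3/(16*ε^2))*((ε+T)*σ^2) - 3/64 ≤ (3/(16*ε^2))*(σ^4 + σ^2*T) := by
      have : (3/(16*ε^2))*(σ^4 + σ^2*T) - ((3/(16*ε^2))*((ε+T)*σ^2) - 3/64) = (3/(16*ε^2))*(σ^2-ε/2)^2 := by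
        field_simp; ring
      have h3 : 0 ≤ (3/(16*ε^2))*(σ^2-ε/2)^2 := by positivity
      linarith
    have h4 := quad_low ((3/(16*ε^2))*(ε+T)) ((a/ε)*F) σ (by positivity)
    have h5 : ((a/ε)*F)^2/(4*((3/(16*ε^2))*(ε+T))) = (4/3)*a^2*F^2*(1/(ε+T)) := by field_simp; norm_num
    have h6 : (4/3)*a^2*F^2*(1/(ε+T)) ≤ 2*a^2*F^2*(1/(ε^2+T)) := by
      have : ε^2 ≤ ε := by nlinarith
      gcongr
      norm_num
    rw [h5] at h4
    linarith

lemma low2 (ε a F V n m0 : ℝ) (hε : 0 < ε) (hm0 : 0 < m0) (hn : m0 ≤ n) :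
    - (a^2/(2*m0)*F^2) ≤ n*V^2/(2*ε^2) - (a/ε)*F*V := by
  have h1 : m0*V^2/(2*ε^2) ≤ n*V^2/(2*ε^2) := by gcongr
  have h4 := quad_low (m0/(2*ε^2)) ((a/ε)*F) V (by positivity)
  have h5 : ((a/ε)*F)^2/(4*(m0/(2*ε^2))) = a^2/(2*m0)*F^2 := by field_simp; norm_num
  rw [h5] at h4
  have : m0/(2*ε^2)*V^2 = m0*V^2/(2*ε^2) := by ring
  linarith

lemma eden_eq (ε a : ℝ) (hε : 0 < ε) (μ : E2 → ℝ) (f v : E2 → E2) (x : E2) :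
    eden ε a μ f v x + Tden ε a μ f x = Dden ε a μ f v x +
      ((3/(16*ε^2))*(‖v x‖^2-√(max (μ x) 0)^2)^2 + (max (-μ x) 0)*‖v x‖^2/(2*ε^2)
        - (a/ε)*‖f x‖*(‖v x‖-√(max (μ x) 0))) := by
  have h1 : √(max (μ x) 0)^2 = max (μ x) 0 := Real.sq_sqrt (le_max_right _ _)
  have h2 : μ x = max (μ x) 0 - max (-μ x) 0 := by
    rcases le_total (μ x) 0 with h | h
    · rw [max_eq_right h, max_eq_left (by linarith)]; ring
    · rw [max_eq_left h, max_eq_right (by linarith)]; ring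
  rw [h1]
  simp only [eden, Tden, Dden]
  generalize √(max (μ x) 0) = p at *
  generalize max (μ x) 0 = P at *
  generalize max (-μ x) 0 = n at *
  rw [h2]
  field_simp
  ring

lemma lower_point {μ : E2 → ℝ} {μrad : ℝ → ℝ} {ρ : ℝ} {f : E2 → E2} {frad : ℝ → ℝ}
    (hμ : MuHyp μ μrad ρ) (hf : FHyp f frad) (C : ℝ) (hC : 0 < C) :
    ∃ K2 K3 : ℝ, 0 < K2 ∧ 0 < K3 ∧ ∀ ε, 0 < ε → ε ≤ 1 → ∀ a, 0 < a → a ≤ C → ∀ (v : E2 → E2) x,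
      Dden ε a μ f v x ≤ eden ε a μ f v x + Tden ε a μ f x + (K2 * qden ρ μ ε x + K3 * ‖f x‖^2) := by
  obtain ⟨Mf, hMf⟩ := hf.bdd
  have hMf0 : 0 ≤ Mf := (norm_nonneg _).trans (hMf 0)
  have hρ := hμ.rho_pos
  have hm0 : 0 < -μrad (2*ρ) := by
    have := mu_anti hμ (mem_Ici.2 hρ.le) (mem_Ici.2 (by linarith : 0 ≤ 2*ρ)) (by linarith)
    rw [hμ.rho_root] at this; linarith
  refine ⟨1 + 2*C^2*Mf^2, C^2/(2*(-μrad (2*ρ))), by positivity, by positivity, ?_⟩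
  intro ε hε hε1 a ha haC v x
  rw [eden_eq ε a hε]
  by_cases hx : ‖x‖ < 2*ρ
  · have hq : qden ρ μ ε x = 1 + 1/(ε^2+|μ x|) + 1/(‖x‖^2+ε^2) := by
      rw [qden, indicator_of_mem (by simp [hx])]
    have h1 := low1 ε a ‖f x‖ ‖v x‖ (√(max (μ x) 0)) (max (-μ x) 0) hε hε1 ha (norm_nonneg _)
      (norm_nonneg _) (Real.sqrt_nonneg _) (le_max_right _ _)
    have h2 : √(max (μ x) 0)^2 + max (-μ x) 0 = |μ x| := by
      rw [Real.sq_sqrt (le_max_right _ _)]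
      rcases le_total (μ x) 0 with h | h
      · rw [max_eq_right h, max_eq_left (by linarith), abs_of_nonpos h]; ring
      · rw [max_eq_left h, max_eq_right (by linarith), abs_of_nonneg h]; ring
    rw [h2] at h1
    rw [hq]
    have h3 : 2*a^2*‖f x‖^2*(1/(ε^2+|μ x|)) ≤ 2*C^2*Mf^2*(1/(ε^2+|μ x|)) := by
      gcongr; exact hMf x
    have hA : 0 < 1/(ε^2+|μ x|) := by positivity
    have hB : 0 < 1/(‖x‖^2+ε^2) := by positivity
    have h4 : 0 ≤ C^2/(2*(-μrad (2*ρ))) * ‖f x‖^2 := by positivity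
    have h5 : 0 ≤ 2*C^2*Mf^2 := by positivity
    generalize 1/(ε^2+|μ x|) = A at *
    generalize 1/(‖x‖^2+ε^2) = B at *
    generalize 2*C^2*Mf^2 = X at *
    nlinarith [mul_nonneg h5 hB.le]
  · push Not at hx
    have hle : μ x ≤ μrad (2*ρ) := by
      rw [hμ.radial]
      exact (mu_anti hμ).antitoneOn (mem_Ici.2 (by linarith)) (mem_Ici.2 (norm_nonneg _)) hx
    have h1 := low2 ε a ‖f x‖ ‖v x‖ (-μ x) (-μrad (2*ρ)) hε hm0 (by linarith)
    have h0 : μ x ≤ 0 := by linarith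
    rw [max_eq_right h0, max_eq_left (by linarith), Real.sqrt_zero, sub_zero]
    have hq : 0 ≤ (1 + 2*C^2*Mf^2) * qden ρ μ ε x :=
      mul_nonneg (by positivity) (indicator_nonneg (fun _ _ => by positivity) _)
    have h3 : a^2/(2*(-μrad (2*ρ))) * ‖f x‖^2 ≤ C^2/(2*(-μrad (2*ρ))) * ‖f x‖^2 := by gcongr
    have h4 : 0 ≤ (3/(16*ε^2))*(‖v x‖^2-0^2)^2 := by positivity
    linarith

lemma D_bound {μ : E2 → ℝ} {μrad : ℝ → ℝ} {ρ : ℝ} {f : E2 → E2} {frad : ℝ → ℝ}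
    (hμ : MuHyp μ μrad ρ) (hf : FHyp f frad) (C : ℝ) (hC : 0 < C) :
    ∃ K ε1 : ℝ, 0 < K ∧ 0 < ε1 ∧ ε1 ≤ exp (-1) ∧ ∀ ε, 0 < ε → ε < ε1 → ∀ a, 0 < a → a ≤ C →
      ∀ v : E2 → E2, IsMinimizer ε a μ f v →
        Measurable (Dden ε a μ f v) ∧ Integrable (Dden ε a μ f v) ∧
          ∫ x, Dden ε a μ f v x ≤ K * (-log ε) := by
  obtain ⟨K1, hK1, htest⟩ := test_exists hμ hf C hC
  obtain ⟨K2, K3, hK2, hK3, hlow⟩ := lower_point hμ hf C hC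
  obtain ⟨Kq, hKq, hqb⟩ := qden_bound hμ
  obtain ⟨Mf, hMf⟩ := hf.bdd
  have hμc : Continuous μ := hμ.smooth.continuous
  have hfc : Continuous f := hf.smooth.continuous
  have hsupp : ∀ x, x ∉ Metric.closedBall (0:E2) ρ → max (μ x) 0 = 0 := by
    intro x hx
    simp at hx
    refine max_eq_right ?_
    by_contra h; push Not at h
    exact absurd ((mu_pos_iff hμ x).1 h) (by linarith)
  have hIc : HasCompactSupport (fun x => (max (μ x) 0)^2) :=
    HasCompactSupport.intro (isCompact_closedBall (0:E2) ρ) fun x hx => by simp [hsupp x hx]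
  have hIcont : Continuous (fun x => (max (μ x) 0)^2) := by fun_prop
  have hIi : Integrable (fun x => (max (μ x) 0)^2) := hIcont.integrable_of_hasCompactSupport hIc
  have hI0 : 0 < ∫ x, (max (μ x) 0)^2 := by
    refine hIcont.integral_pos_of_hasCompactSupport_nonneg_nonzero (x := 0) hIc (fun x => by positivity) ?_
    have := (mu_pos_iff hμ 0).2 (by simpa using hμ.rho_pos)
    rw [max_eq_left this.le]; positivity
  set I0 := ∫ x, (max (μ x) 0)^2
  have hf2 : Integrable (fun x => ‖f x‖^2) := by
    refine (hf.integrable.norm.const_mul Mf).mono' (by fun_prop) (.of_forall fun x => ?_)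
    rw [Real.norm_of_nonneg (by positivity), sq]
    gcongr; exact hMf x
  have hJ : 0 ≤ ∫ x, ‖f x‖^2 := integral_nonneg fun x => by positivity
  refine ⟨(K1+K2)*Kq + K3 * ∫ x, ‖f x‖^2, min (exp (-1)) (I0/(4*(K1*Kq))), by positivity, ?_, min_le_left _ _, ?_⟩
  · exact lt_min (exp_pos _) (by positivity)
  intro ε hε hε1 a ha haC v hv
  have he1 : ε ≤ exp (-1) := hε1.le.trans (min_le_left _ _)
  have he2 : ε < I0/(4*(K1*Kq)) := hε1.trans_le (min_le_right _ _)
  have hε11 : ε ≤ 1 := he1.trans (Real.exp_le_one_iff.2 (by norm_num))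
  have hL : 1 ≤ -log ε := by
    have := Real.log_le_log hε he1
    rw [Real.log_exp] at this; linarith
  have hTi : Integrable (Tden ε a μ f) := by
    have hc : Continuous (Tden ε a μ f) := by unfold Tden; fun_prop
    refine hc.integrable_of_hasCompactSupport (HasCompactSupport.intro (isCompact_closedBall (0:E2) ρ) fun x hx => ?_)
    simp [Tden, hsupp x hx]
  have hqi := qden_integrable hμc ρ ε hε
  have hqbε := hqb ε hε he1
  obtain ⟨u, hu, hui, hub⟩ := htest ε hε hε11 a ha haC
  have hEu : energy ε a μ f u + ∫ x, Tden ε a μ f x ≤ K1 * (Kq * (-log ε)) := by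
    rw [energy_eq, ← integral_add hui hTi]
    refine (integral_mono (hui.add hTi) (hqi.const_mul K1) hub).trans ?_
    rw [integral_const_mul]
    gcongr
  have hT : I0/(4*ε^2) ≤ ∫ x, Tden ε a μ f x := by
    have : I0/(4*ε^2) = ∫ x, (max (μ x) 0)^2/(4*ε^2) := (integral_div _ _).symm
    rw [this]
    refine integral_mono (hIi.div_const _) hTi fun x => ?_
    have : 0 ≤ (a/ε)*‖f x‖*√(max (μ x) 0) := by positivity
    simp only [Tden]; linarith
  have hneg : energy ε a μ f u < 0 := by
    have h1 : -log ε < 1/ε := by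
      have := Real.log_le_sub_one_of_pos (inv_pos.2 hε)
      rw [Real.log_inv] at this
      rw [one_div]; linarith
    have h2 : K1 * (Kq * (-log ε)) < I0/(4*ε^2) := by
      calc K1 * (Kq * (-log ε)) < K1 * (Kq * (1/ε)) := by gcongr
        _ < I0/(4*ε^2) := by
          rw [lt_div_iff₀ (by positivity)] at he2 ⊢
          have : K1 * (Kq * (1/ε)) * (4*ε^2) = ε * (4*(K1*Kq)) := by field_simp
          rw [this]; exact he2
    linarith
  have hle : energy ε a μ f v ≤ energy ε a μ f u := hv.2 u hu
  have hvi : Integrable (eden ε a μ f v) := by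
    by_contra h
    have : energy ε a μ f v = 0 := by rw [energy_eq]; exact integral_undef h
    linarith
  have hvc : Continuous v := hv.1.1.continuous
  have hDm : Measurable (Dden ε a μ f v) := by
    have h1 := measurable_gradSq v
    have h2 : Measurable (fun x => (1/(16*ε^2)) * (‖v x‖^2 - max (μ x) 0)^2
      + (a/ε) * (‖f x‖ * ‖v x‖ - (inner ℝ (f x) (v x) : ℝ))) := by
      apply Continuous.measurable; fun_prop
    have h3 := (h1.const_mul (1/2)).add h2
    convert h3 using 1
    ext x; simp only [Dden, Pi.add_apply]; ring
  have hGi : Integrable (fun x => eden ε a μ f v x + Tden ε a μ f x + (K2 * qden ρ μ ε x + K3 * ‖f x‖^2)) :=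
    (hvi.add hTi).add ((hqi.const_mul K2).add (hf2.const_mul K3))
  have hDi : Integrable (Dden ε a μ f v) := by
    refine hGi.mono' hDm.aestronglyMeasurable (.of_forall fun x => ?_)
    rw [Real.norm_of_nonneg (Dden_nonneg ε a hε ha μ f v x)]
    exact hlow ε hε hε11 a ha haC v x
  refine ⟨hDm, hDi, ?_⟩
  have hfin := integral_mono hDi hGi (hlow ε hε hε11 a ha haC v)
  have e1 : ∫ x, (eden ε a μ f v x + Tden ε a μ f x + (K2 * qden ρ μ ε x + K3 * ‖f x‖^2)) =
      energy ε a μ f v + (∫ x, Tden ε a μ f x) + (K2 * (∫ x, qden ρ μ ε x) + K3 * ∫ x, ‖f x‖^2) := by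
    rw [← integral_const_mul, ← integral_const_mul, energy_eq, ← integral_add (hqi.const_mul K2) (hf2.const_mul K3),
      ← integral_add hvi hTi]
    exact integral_add (hvi.add hTi) ((hqi.const_mul K2).add (hf2.const_mul K3))
  rw [e1] at hfin
  have h8 : K2 * (∫ x, qden ρ μ ε x) ≤ K2 * (Kq * (-log ε)) := by gcongr
  have h9 : K3 * (∫ x, ‖f x‖^2) ≤ K3 * (∫ x, ‖f x‖^2) * (-log ε) :=
    le_mul_of_one_le_right (by positivity) hL
  calc _ ≤ _ := hfin
    _ ≤ K1 * (Kq * (-log ε)) + (K2 * (Kq * (-log ε)) + K3 * (∫ x, ‖f x‖^2) * (-log ε)) := by linarith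
    _ = _ := by ring


lemma key_lemma {μ : E2 → ℝ} {μrad : ℝ → ℝ} {ρ : ℝ} {f : E2 → E2} {frad : ℝ → ℝ}
    (hμ : MuHyp μ μrad ρ) (hf : FHyp f frad) (C : ℝ) (hC : 0 < C)
    (ρ0 : ℝ) (hρ0 : 0 < ρ0) (hρ0ρ : ρ0 < ρ) :
    ∃ b ε0 : ℝ, 0 < b ∧ 0 < ε0 ∧ ∀ ε, 0 < ε → ε < ε0 → ∀ a, 0 < a → a ≤ C →
      b < a / (ε * (Real.log ε)^2) → ∀ v : E2 → E2, IsMinimizer ε a μ f v →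
        ∃ x, ‖x‖ ≤ ρ0 ∧ v x = 0 := by
  obtain ⟨K0, ε1, hK0, hε1, hε1e, hD⟩ := D_bound hμ hf C hC
  have hμ0 : 0 < μrad ρ0 := by
    have := mu_anti hμ (mem_Ici.2 hρ0.le) (mem_Ici.2 hμ.rho_pos.le) hρ0ρ
    rwa [hμ.rho_root] at this
  obtain ⟨m, hm, hm2⟩ : ∃ m : ℝ, 0 < m ∧ 4*m^2 = μrad ρ0 :=
    ⟨√(μrad ρ0)/2, by positivity, by rw [div_pow, Real.sq_sqrt hμ0.le]; ring⟩
  obtain ⟨r0, hr0, hr0min⟩ := (isCompact_Icc (a := ρ0/2) (b := ρ0)).exists_isMinOn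
    ⟨ρ0, by constructor <;> linarith⟩ hf.smooth_rad.continuous.continuousOn
  have hF0 : 0 < frad r0 := hf.pos_rad r0 (by linarith [hr0.1])
  have hFmin : ∀ r, ρ0/2 < r → r < ρ0 → frad r0 ≤ frad r := fun r h1 h2 => hr0min ⟨h1.le, h2.le⟩
  set F0 := frad r0
  set K := K0 + m^2/128 with hKdef
  have hK : 0 < K := by positivity
  refine ⟨1024*K^2/(F0*m^3*ρ0^2), min ε1 (m^6*ρ0^2/(8192*K^2)), by positivity,
    lt_min hε1 (by positivity), ?_⟩
  intro ε hε hεlt a ha haC hb v hv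
  have he1 : ε < ε1 := hεlt.trans_le (min_le_left _ _)
  have he2 : ε < m^6*ρ0^2/(8192*K^2) := hεlt.trans_le (min_le_right _ _)
  have hL : 1 ≤ -log ε := by
    have := Real.log_le_log hε (he1.le.trans hε1e)
    rw [Real.log_exp] at this; linarith
  obtain ⟨hDm, hDi, hDb⟩ := hD ε hε he1 a ha haC v hv
  by_contra hnz
  push Not at hnz
  have hLL : (log ε)^2 = (-log ε)^2 := by ring
  have hLup : (-log ε)^2 * ε < 4 := by
    have hsε : 0 < √ε := Real.sqrt_pos.2 hε
    have h1 := Real.log_le_sub_one_of_pos (inv_pos.2 hsε)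
    rw [Real.log_inv, Real.log_sqrt hε.le] at h1
    have h2 : -log ε * √ε < 2 := by
      have : -log ε < 2 * (√ε)⁻¹ := by linarith
      calc -log ε * √ε < 2 * (√ε)⁻¹ * √ε := by gcongr
        _ = 2 := by field_simp
    have h3 : (-log ε * √ε)^2 < 2^2 := by
      have : 0 ≤ -log ε * √ε := by positivity
      gcongr
    rw [mul_pow, Real.sq_sqrt hε.le] at h3
    linarith
  have hμlow : ∀ x : E2, ‖x‖ < ρ0 → 4*m^2 ≤ μ x := by
    intro x hx
    rw [hm2, hμ.radial]
    exact (mu_anti hμ).antitoneOn (mem_Ici.2 (norm_nonneg _)) (mem_Ici.2 hρ0.le) hx.le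
  have hin0 : ∀ x, 0 ≤ ‖f x‖ * ‖v x‖ - (inner ℝ (f x) (v x) : ℝ) := fun x => by
    linarith [real_inner_le_norm (f x) (v x)]
  have hbound : ∫ x, Dden ε a μ f v x ≤ K * (-log ε) := by
    refine hDb.trans ?_
    have : K0 ≤ K := by rw [hKdef]; linarith [sq_nonneg m]
    gcongr
  have res := no_zero_bound v hv.1.1 (Dden ε a μ f v) hDm (Dden_nonneg ε a hε ha μ f v) hDi K (-log ε) hK hL
    hbound ρ0 m ε ((a/ε)*F0) hρ0 hm (by positivity) ?_ ?_ ?_ ?_ hnz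
  · generalize -log ε = L at *
    have hL0 : 0 < L := by linarith
    rcases res with h | h
    · rw [hLL, div_lt_div_iff₀ (by positivity) (by positivity)] at hb
      rw [le_div_iff₀ (by positivity)] at h
      have e : a / ε * F0 * (m / 2) * (m ^ 2 / (128 * K * L)) * ρ0^2 = (a * (F0*m^3*ρ0^2)) / (256*K*L*ε) := by
        field_simp; norm_num
      rw [e, div_le_iff₀ (by positivity)] at h
      nlinarith
    · rw [le_div_iff₀ (by positivity)] at h
      have e : m ^ 4 / (4 * ε ^ 2) * (m ^ 2 / (128 * K * L)) * ρ0^2 = (m^6*ρ0^2) / (512*K*L*ε^2) := by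
        field_simp; norm_num
      rw [e, div_le_iff₀ (by positivity)] at h
      rw [lt_div_iff₀ (by positivity)] at he2
      have h5 : 4 * K * L * (512*K*L*ε^2) = 2048*K^2*ε*(L^2*ε) := by ring
      rw [h5] at h
      have h6 : 2048*K^2*ε*(L^2*ε) < 2048*K^2*ε*4 := by gcongr
      linarith
  · rw [div_le_one (by positivity), hKdef]; linarith
  · intro x
    have := hin0 x
    have h2 : 0 ≤ (1/(16*ε^2)) * (‖v x‖^2 - max (μ x) 0)^2 := by positivity
    have h3 : 0 ≤ (a/ε) * (‖f x‖ * ‖v x‖ - (inner ℝ (f x) (v x) : ℝ)) := by positivity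
    simp only [Dden]; linarith
  · intro x _ hx hvx
    have h1 := hμlow x hx
    have h3 : 0 ≤ (a/ε) * (‖f x‖ * ‖v x‖ - (inner ℝ (f x) (v x) : ℝ)) := by
      have := hin0 x; positivity
    have h4 : max (μ x) 0 = μ x := max_eq_left (by nlinarith [sq_nonneg m])
    have h5 : (2*m^2)^2 ≤ (‖v x‖^2 - μ x)^2 := by
      rw [← neg_sub, neg_sq]
      have : 2*m^2 ≤ μ x - ‖v x‖^2 := by linarith
      have h6 : 0 ≤ 2*m^2 := by positivity
      gcongr
    have h7 : m^4/(4*ε^2) = (1/(16*ε^2)) * (2*m^2)^2 := by field_simp; norm_num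
    have h8 : (1/(16*ε^2)) * (2*m^2)^2 ≤ (1/(16*ε^2)) * (‖v x‖^2 - μ x)^2 := by gcongr
    simp only [Dden, h4]
    linarith [gradSq_nonneg v x]
  · intro r θ hr1 hr2
    have hr : 0 < r := by linarith
    have hn : ‖r • uvec θ‖ = r := by rw [norm_smul, norm_uvec, mul_one, Real.norm_of_nonneg hr.le]
    have hne : r • uvec θ ≠ 0 := by rw [← norm_pos_iff, hn]; exact hr
    have hfr : f (r • uvec θ) = frad r • uvec θ := by
      rw [hf.radial _ hne, hn, smul_smul]
      congr 1; field_simp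
    have hfp := hf.pos_rad r hr
    have hfn : ‖f (r • uvec θ)‖ = frad r := by
      rw [hfr, norm_smul, norm_uvec, mul_one, Real.norm_of_nonneg hfp.le]
    set x := r • uvec θ
    have hi : (inner ℝ (f x) (v x) : ℝ) = frad r * inner ℝ (v x) (uvec θ) := by
      rw [hfr, inner_smul_left, real_inner_comm]; simp
    have hi0 : 0 ≤ ‖v x‖ - inner ℝ (v x) (uvec θ) := by
      have := real_inner_le_norm (v x) (uvec θ)
      rw [norm_uvec, mul_one] at this; linarith
    have h2 : 0 ≤ (1/(16*ε^2)) * (‖v x‖^2 - max (μ x) 0)^2 := by positivity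
    have h3 : (a/ε)*F0*(‖v x‖ - inner ℝ (v x) (uvec θ)) ≤ (a/ε)*frad r*(‖v x‖ - inner ℝ (v x) (uvec θ)) := by
      have := hFmin r hr1 hr2
      gcongr
    simp only [Dden]
    rw [hi, hfn]
    have := gradSq_nonneg v x
    linarith

lemma final
    (μ : E2 → ℝ) (μrad : ℝ → ℝ) (ρ : ℝ) (f : E2 → E2) (frad : ℝ → ℝ)
    (hμ : MuHyp μ μrad ρ) (hf : FHyp f frad)
    (ρ0 : ℝ) (hρ0 : 0 < ρ0) (hρ0ρ : ρ0 < ρ) (C : ℝ) (hC : 0 < C) :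
    ∃ bstar : ℝ, 0 < bstar ∧
      ∀ (a : ℝ → ℝ) (v : ℝ → E2 → E2),
        (∀ ε : ℝ, 0 < ε → 0 < a ε) → (∀ ε : ℝ, 0 < ε → a ε ≤ C) →
        (∀ ε : ℝ, 0 < ε → IsMinimizer ε (a ε) μ f (v ε)) →
        ((bstar < Filter.limsup (fun ε : ℝ => a ε / (ε * (Real.log ε)^2)) (𝓝[>] (0:ℝ)) →
          ∃ l : E2, IsZeroLimitPoint v l ∧ ‖l‖ ≤ ρ0) ∧
        ((∀ M : ℝ, ∃ᶠ ε in 𝓝[>] (0:ℝ), M < a ε / (ε * (Real.log ε)^2)) →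
          IsZeroLimitPoint v 0)) := by
  obtain ⟨b, ε0, hb, hε0, hkey⟩ := key_lemma hμ hf C hC ρ0 hρ0 hρ0ρ
  refine ⟨b, hb, fun a v ha haC hmin => ⟨fun hlim => ?_, fun hfr => ?_⟩⟩
  · have hfreq : ∃ᶠ ε in 𝓝[>] (0:ℝ), b < a ε / (ε * (Real.log ε)^2) := by
      intro hev
      have hev' : ∀ᶠ ε in 𝓝[>] (0:ℝ), a ε / (ε * (Real.log ε)^2) ≤ b := by
        filter_upwards [hev] with ε h using not_lt.1 h
      have hcob : IsCoboundedUnder (· ≤ ·) (𝓝[>] (0:ℝ)) (fun ε : ℝ => a ε / (ε * (Real.log ε)^2)) := by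
        refine IsBoundedUnder.isCoboundedUnder_le ⟨0, ?_⟩
        rw [eventually_map]
        filter_upwards [self_mem_nhdsWithin] with ε hε
        have hε' : 0 < ε := hε
        have := ha ε hε'
        show 0 ≤ a ε / (ε * (Real.log ε)^2)
        positivity
      exact absurd (Filter.limsup_le_of_le hcob hev') (not_le.2 hlim)
    have hex : ∀ n : ℕ, ∃ (ε : ℝ) (x : E2), 0 < ε ∧ ε < 1/((n:ℝ)+1) ∧ ‖x‖ ≤ ρ0 ∧ v ε x = 0 := by
      intro n
      have hδ : 0 < min ε0 (1/((n:ℝ)+1)) := lt_min hε0 (by positivity)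
      obtain ⟨ε, h1, h2⟩ := (hfreq.and_eventually (Ioo_mem_nhdsGT hδ)).exists
      obtain ⟨x, hx, hvx⟩ := hkey ε h2.1 (h2.2.trans_le (min_le_left _ _)) (a ε) (ha ε h2.1) (haC ε h2.1) h1
        (v ε) (hmin ε h2.1)
      exact ⟨ε, x, h2.1, h2.2.trans_le (min_le_right _ _), hx, hvx⟩
    choose εs xs h1 h2 h3 h4 using hex
    obtain ⟨l, hl, g, hg, hgl⟩ := (isCompact_closedBall (0:E2) ρ0).tendsto_subseq (x := xs)
      (fun n => by simpa using h3 n)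
    have ht : Tendsto εs atTop (𝓝 0) :=
      squeeze_zero (fun n => (h1 n).le) (fun n => (h2 n).le) tendsto_one_div_add_atTop_nhds_zero_nat
    exact ⟨l, ⟨εs ∘ g, xs ∘ g, fun n => h1 _, ht.comp hg.tendsto_atTop, fun n => h4 _, hgl⟩, by simpa using hl⟩
  · have hex : ∀ n : ℕ, ∃ (ε : ℝ) (x : E2), 0 < ε ∧ ε < 1/((n:ℝ)+1) ∧ ‖x‖ ≤ 1/((n:ℝ)+1) ∧ v ε x = 0 := by
      intro n
      have hn : 0 < 1/((n:ℝ)+1) := by positivity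
      obtain ⟨b', ε', hb', hε', hkey'⟩ := key_lemma hμ hf C hC (min ρ0 (1/((n:ℝ)+1)))
        (lt_min hρ0 hn) ((min_le_left _ _).trans_lt hρ0ρ)
      obtain ⟨ε, h1, h2⟩ := ((hfr b').and_eventually (Ioo_mem_nhdsGT (lt_min hε' hn))).exists
      obtain ⟨x, hx, hvx⟩ := hkey' ε h2.1 (h2.2.trans_le (min_le_left _ _)) (a ε) (ha ε h2.1) (haC ε h2.1) h1
        (v ε) (hmin ε h2.1)
      exact ⟨ε, x, h2.1, h2.2.trans_le (min_le_right _ _), hx.trans (min_le_right _ _), hvx⟩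
    choose εs xs h1 h2 h3 h4 using hex
    exact ⟨εs, xs, h1,
      squeeze_zero (fun n => (h1 n).le) (fun n => (h2 n).le) tendsto_one_div_add_atTop_nhds_zero_nat, h4,
      squeeze_zero_norm h3 tendsto_one_div_add_atTop_nhds_zero_nat⟩

/-- for every `ρ₀ ∈ (0,ρ)` there exists `b* > 0` such that if `a` is
bounded and `limsup_{ε→0} a/(ε|ln ε|²) > b*`, the zeros of the global minimizers
have a limit point `l` with `|l| ≤ ρ₀`; if moreover the ratio is unbounded
(`limsup = ∞`), then there is a sequence of zeros converging to `0`. -/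
theorem statement17
    (μ : E2 → ℝ) (μrad : ℝ → ℝ) (ρ : ℝ) (f : E2 → E2) (frad : ℝ → ℝ)
    (hμ : MuHyp μ μrad ρ) (hf : FHyp f frad)
    (ρ0 : ℝ) (hρ0 : 0 < ρ0) (hρ0ρ : ρ0 < ρ) (C : ℝ) (hC : 0 < C) :
    ∃ bstar : ℝ, 0 < bstar ∧
      ∀ (a : ℝ → ℝ) (v : ℝ → E2 → E2),
        (∀ ε : ℝ, 0 < ε → 0 < a ε) → (∀ ε : ℝ, 0 < ε → a ε ≤ C) →
        (∀ ε : ℝ, 0 < ε → IsMinimizer ε (a ε) μ f (v ε)) →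
        ((bstar < Filter.limsup (fun ε : ℝ => a ε / (ε * (Real.log ε)^2)) (𝓝[>] (0:ℝ)) →
          ∃ l : E2, IsZeroLimitPoint v l ∧ ‖l‖ ≤ ρ0) ∧
        ((∀ M : ℝ, ∃ᶠ ε in 𝓝[>] (0:ℝ), M < a ε / (ε * (Real.log ε)^2)) →
          IsZeroLimitPoint v 0)) := by
  exact final μ μrad ρ f frad hμ hf ρ0 hρ0 hρ0ρ C hC
end
end

section
/- For every a > 0 let μ_a : ℝ² → ℝ be a measurable function with μ_a ≤ μ pointwise and μ_a → −∞ almost everywhere as a → ∞. Then given ε > 0 there exists A > 0 such that for every a > A and every nonzero ψ ∈ H¹(ℝ²,ℝ²): ∫_{ℝ²} μ_a|ψ|² < ε² ∫_{ℝ²} |∇ψ|². -/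
open MeasureTheory Filter Real Set
open scoped Topology ENNReal

noncomputable section

lemma oneD_bound (g g' : ℝ → ℝ) (hd : ∀ t, HasDerivAt g (g' t) t) 
    (hfin : ∫⁻ t, ENNReal.ofReal (g t) ≠ ∞) (x : ℝ) :
    ENNReal.ofReal (g x) ≤ ∫⁻ t, ‖g' t‖ₑ := by
  by_contra hcon
  push Not at hcon
  have hg' : g' = deriv g := by
    ext t; exact (hd t).deriv.symm
  have hmeas : Measurable g' := by rw [hg']; exact measurable_deriv g
  have hint : Integrable g' := ⟨hmeas.aestronglyMeasurable, hcon.trans ENNReal.ofReal_lt_top⟩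
  have hD : ∫⁻ t, ‖g' t‖ₑ = ENNReal.ofReal (∫ t, ‖g' t‖) :=
    (ofReal_integral_norm_eq_lintegral_enorm hint).symm
  set D := ∫ t, ‖g' t‖ with hDdef
  have hD0 : 0 ≤ D := integral_nonneg (fun _ => norm_nonneg _)
  rw [hD] at hcon
  have hlt : D < g x := by
    by_contra h
    exact absurd (ENNReal.ofReal_le_ofReal (not_lt.mp h)) (not_le.mpr hcon)
  have hz : ∀ z, g x - D ≤ g z := by
    intro z
    have h1 := intervalIntegral.integral_eq_sub_of_hasDerivAt (a := z) (b := x)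
      (fun t _ => hd t) hint.intervalIntegrable
    have h2 : ‖∫ t in z..x, g' t‖ ≤ D :=
      (intervalIntegral.norm_integral_le_integral_norm_uIoc).trans
        (setIntegral_le_integral hint.norm (Eventually.of_forall fun _ => norm_nonneg _))
    rw [h1] at h2
    have := (abs_le.mp h2).2
    linarith
  apply hfin
  have : ∫⁻ _ : ℝ, ENNReal.ofReal (g x - D) ≤ ∫⁻ t, ENNReal.ofReal (g t) :=
    lintegral_mono fun t => ENNReal.ofReal_le_ofReal (hz t)
  rw [lintegral_const, Real.volume_univ, ENNReal.mul_top] at this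
  · exact top_le_iff.mp this
  · simpa using hlt

lemma line_bound (u u' : ℝ → E2) (hd : ∀ t, HasDerivAt u (u' t) t)
    (hfin : ∫⁻ t, ‖u t‖ₑ ^ 2 ≠ ∞) (x : ℝ) :
    ‖u x‖ₑ ^ 2 ≤ ∫⁻ t, 2 * (‖u t‖ₑ * ‖u' t‖ₑ) := by
  have key : ∀ t, ‖u t‖ₑ ^ 2 = ENNReal.ofReal (‖u t‖ ^ 2) := fun t => by
    rw [ENNReal.ofReal_pow (norm_nonneg _), ofReal_norm]
  simp only [key] at hfin ⊢
  refine (oneD_bound _ _ (fun t => (hd t).norm_sq) hfin x).trans ?_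
  refine lintegral_mono fun t => ?_
  rw [← ofReal_norm, ← ofReal_norm, ← ofReal_norm, ← ENNReal.ofReal_mul (norm_nonneg _)]
  have h2 : ∀ r : ℝ, 2 * ENNReal.ofReal r = ENNReal.ofReal (2 * r) := fun r => by
    rw [ENNReal.ofReal_mul (by norm_num)]; simp
  rw [h2]
  apply ENNReal.ofReal_le_ofReal
  rw [norm_mul]
  simp only [Real.norm_ofNat]
  gcongr
  exact norm_inner_le_norm _ _

lemma cs_sq {α : Type*} [MeasurableSpace α] (ν : Measure α) (f g : α → ℝ≥0∞)
    (hf : AEMeasurable f ν) (hg : AEMeasurable g ν) :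
    (∫⁻ a, f a * g a ∂ν) ^ 2 ≤ (∫⁻ a, f a ^ 2 ∂ν) * ∫⁻ a, g a ^ 2 ∂ν := by
  have h := ENNReal.lintegral_mul_le_Lp_mul_Lq ν Real.HolderConjugate.two_two hf hg
  have h2 := pow_le_pow_left' h 2
  refine h2.trans (le_of_eq ?_)
  rw [mul_pow, ← ENNReal.rpow_natCast, ← ENNReal.rpow_natCast, ← ENNReal.rpow_mul,
    ← ENNReal.rpow_mul]
  norm_num

def pt : ℝ × ℝ ≃ᵐ E2 :=
  (MeasurableEquiv.finTwoArrow (α := ℝ)).symm.trans (MeasurableEquiv.toLp 2 (Fin 2 → ℝ))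

lemma pt_mp : MeasurePreserving pt (volume : Measure (ℝ × ℝ)) (volume : Measure E2) := by
  have h1 := (volume_preserving_finTwoArrow ℝ).symm
  have h2 := PiLp.volume_preserving_toLp (Fin 2)
  exact h2.comp h1

lemma pt_apply (s t : ℝ) : pt (s, t) = s • e2basis 0 + t • e2basis 1 := by
  ext i
  fin_cases i <;> simp [pt, e2basis, MeasurableEquiv.finTwoArrow]

lemma ladyz (ψ : E2 → E2) (hd : Differentiable ℝ ψ) (hfin : ∫⁻ x, ‖ψ x‖ₑ ^ 2 ≠ ∞) :
    ∫⁻ x, ‖ψ x‖ₑ ^ 4 ≤ (∫⁻ x, 2 * (‖ψ x‖ₑ * ‖fderiv ℝ ψ x (e2basis 0)‖ₑ)) *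
      ∫⁻ x, 2 * (‖ψ x‖ₑ * ‖fderiv ℝ ψ x (e2basis 1)‖ₑ) := by
  have hψm : Measurable ψ := hd.continuous.measurable
  have hm : ∀ i, Measurable fun x => fderiv ℝ ψ x (e2basis i) :=
    fun i => measurable_fderiv_apply_const ℝ ψ _
  have hF : ∀ i, Measurable fun x => 2 * (‖ψ x‖ₑ * ‖fderiv ℝ ψ x (e2basis i)‖ₑ) := fun i =>
    measurable_const.mul (hψm.enorm.mul (hm i).enorm)
  have hptm : Measurable pt := pt.measurable
  have hfin' : ∫⁻ z, ‖ψ (pt z)‖ₑ ^ 2 ∂((volume : Measure ℝ).prod (volume : Measure ℝ)) ≠ ∞ := by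
    rw [← Measure.volume_eq_prod, ← pt_mp.lintegral_map_equiv (fun x => ‖ψ x‖ₑ ^ 2)]
    exact hfin
  have hm2 : Measurable fun z : ℝ × ℝ => ‖ψ (pt z)‖ₑ ^ 2 := (hψm.comp hptm).enorm.pow_const 2
  set F := fun (i : Fin 2) (z : ℝ × ℝ) =>
    2 * (‖ψ (pt z)‖ₑ * ‖fderiv ℝ ψ (pt z) (e2basis i)‖ₑ) with hFdef
  have hFm : ∀ i, Measurable (F i) := fun i => (hF i).comp hptm
  -- bounds on lines
  have h0 : ∀ᵐ t : ℝ, ∀ s : ℝ, ‖ψ (pt (s, t))‖ₑ ^ 2 ≤ ∫⁻ s', F 0 (s', t) := by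
    have h := hfin'
    rw [lintegral_prod_symm _ hm2.aemeasurable] at h
    filter_upwards [ae_lt_top' (hm2.lintegral_prod_left').aemeasurable h] with t ht s
    refine line_bound (fun s => ψ (pt (s, t))) (fun s => fderiv ℝ ψ (pt (s, t)) (e2basis 0))
      (fun s => ?_) ht.ne s
    have hl : HasDerivAt (fun s => pt (s, t)) (e2basis 0) s := by
      simp only [pt_apply]
      simpa using ((hasDerivAt_id s).smul_const (e2basis 0)).add_const (t • e2basis 1)
    exact (hd _).hasFDerivAt.comp_hasDerivAt s hl
  have h1 : ∀ᵐ s : ℝ, ∀ t : ℝ, ‖ψ (pt (s, t))‖ₑ ^ 2 ≤ ∫⁻ t', F 1 (s, t') := by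
    have h := hfin'
    rw [lintegral_prod _ hm2.aemeasurable] at h
    filter_upwards [ae_lt_top' (hm2.lintegral_prod_right').aemeasurable h] with s hs t
    refine line_bound (fun t => ψ (pt (s, t))) (fun t => fderiv ℝ ψ (pt (s, t)) (e2basis 1))
      (fun t => ?_) hs.ne t
    have hl : HasDerivAt (fun t => pt (s, t)) (e2basis 1) t := by
      simp only [pt_apply]
      simpa using ((hasDerivAt_id t).smul_const (e2basis 1)).const_add (s • e2basis 0)
    exact (hd _).hasFDerivAt.comp_hasDerivAt t hl
  rw [pt_mp.lintegral_map_equiv, pt_mp.lintegral_map_equiv, pt_mp.lintegral_map_equiv,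
    Measure.volume_eq_prod]
  change _ ≤ (∫⁻ z, F 0 z ∂_) * ∫⁻ z, F 1 z ∂_
  rw [lintegral_prod_symm (F 0) (hFm 0).aemeasurable, lintegral_prod (F 1) (hFm 1).aemeasurable,
    lintegral_prod _ (by fun_prop), mul_comm,
    ← lintegral_mul_const _ (hFm 1).lintegral_prod_right']
  refine lintegral_mono_ae ?_
  filter_upwards [h1] with s hs
  rw [← lintegral_const_mul _ (hFm 0).lintegral_prod_left']
  refine lintegral_mono_ae ?_
  filter_upwards [h0] with t ht
  calc ‖ψ (pt (s, t))‖ₑ ^ 4 = ‖ψ (pt (s, t))‖ₑ ^ 2 * ‖ψ (pt (s, t))‖ₑ ^ 2 := by ring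
    _ ≤ _ := mul_le_mul' (hs t) (ht s)

lemma enorm_sq' (v : E2) : ‖v‖ₑ ^ 2 = ENNReal.ofReal (‖v‖ ^ 2) := by
  rw [ENNReal.ofReal_pow (norm_nonneg _), ofReal_norm]

/-- Ladyzhenskaya-type bound. -/
lemma ladyz2 (ψ : E2 → E2) (hd : Differentiable ℝ ψ) (hfin : ∫⁻ x, ‖ψ x‖ₑ ^ 2 ≠ ∞) :
    ∫⁻ x, ‖ψ x‖ₑ ^ 4 ≤ 4 * ((∫⁻ x, ‖ψ x‖ₑ ^ 2) * ∫⁻ x, ENNReal.ofReal (gradSq ψ x)) := by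
  have hψm : Measurable ψ := hd.continuous.measurable
  have hm : ∀ i, Measurable fun x => fderiv ℝ ψ x (e2basis i) :=
    fun i => measurable_fderiv_apply_const ℝ ψ _
  set P := ∫⁻ x, ‖ψ x‖ₑ ^ 2
  set D := ∫⁻ x, ENNReal.ofReal (gradSq ψ x)
  have hI : ∀ i, (∫⁻ x, 2 * (‖ψ x‖ₑ * ‖fderiv ℝ ψ x (e2basis i)‖ₑ)) ^ 2 ≤ 4 * (P * D) := by
    intro i
    have hmm : Measurable fun x => ‖ψ x‖ₑ * ‖fderiv ℝ ψ x (e2basis i)‖ₑ :=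
      hψm.enorm.mul (hm i).enorm
    rw [lintegral_const_mul _ hmm, mul_pow]
    have h4 : (2 : ℝ≥0∞) ^ 2 = 4 := by norm_num
    rw [h4]
    gcongr
    refine (cs_sq _ _ _ hψm.enorm.aemeasurable (hm i).enorm.aemeasurable).trans ?_
    refine mul_le_mul' le_rfl (lintegral_mono fun x => ?_)
    simp only [enorm_sq']
    apply ENNReal.ofReal_le_ofReal
    exact Finset.single_le_sum (f := fun i => ‖fderiv ℝ ψ x (e2basis i)‖ ^ 2)
      (fun i _ => by positivity) (Finset.mem_univ i)
  have h := ladyz ψ hd hfin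
  rw [← ENNReal.pow_le_pow_left_iff (n := 2) two_ne_zero]
  calc _ ≤ _ := pow_le_pow_left' h 2
    _ ≤ (4 * (P * D)) * (4 * (P * D)) := by
      rw [mul_pow]; exact mul_le_mul' (hI 0) (hI 1)
    _ = _ := by ring

lemma final_ineq (L δ ε j m p d : ℝ) (hδ : 0 < δ) (hε : 0 < ε) (hp : 0 < p)
    (hd : 0 ≤ d) (hj : j ^ 2 ≤ 4 * (m * (p * d))) (hm : L ^ 2 * m < δ * ε ^ 2) :
    L * j - δ * p < ε ^ 2 * d := by
  rcases hd.eq_or_lt with rfl | hd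
  · have : j = 0 := by
      have : j ^ 2 ≤ 0 := by simpa using hj
      exact pow_eq_zero_iff two_ne_zero |>.mp (le_antisymm this (sq_nonneg j))
    subst this
    nlinarith
  have h1 : (L * j) ^ 2 ≤ 4 * (L ^ 2 * m) * (p * d) := by
    rw [mul_pow]; nlinarith [mul_le_mul_of_nonneg_left hj (sq_nonneg L)]
  have h2 : 4 * (L ^ 2 * m) * (p * d) < 4 * (δ * ε ^ 2) * (p * d) := by
    have := mul_pos hp hd
    gcongr
  have h3 : (L * j) ^ 2 < (δ * p + ε ^ 2 * d) ^ 2 := by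
    nlinarith [sq_nonneg (δ * p - ε ^ 2 * d)]
  have h4 := abs_lt_of_sq_lt_sq h3 (by positivity)
  linarith [le_abs_self (L * j)]

/-- a Poincaré-type inequality. If `μ_a ≤ μ` are measurable and
`μ_a → −∞` a.e. as `a → ∞`, then given `ε > 0` there is `A > 0` such that for all
`a > A` and nonzero `ψ ∈ H¹(ℝ²,ℝ²)`: `∫ μ_a|ψ|² < ε² ∫ |∇ψ|²`. -/
theorem statement19
    (μ : E2 → ℝ) (μrad : ℝ → ℝ) (ρ : ℝ) (hμ : MuHyp μ μrad ρ)
    (μa : ℝ → E2 → ℝ) (hmeas : ∀ a : ℝ, 0 < a → Measurable (μa a))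
    (hle : ∀ a : ℝ, 0 < a → ∀ x : E2, μa a x ≤ μ x)
    (hlim : ∀ᵐ x : E2 ∂(volume : Measure E2), Tendsto (fun a : ℝ => μa a x) atTop atBot)
    (ε : ℝ) (hε : 0 < ε) :
    ∃ A : ℝ, 0 < A ∧ ∀ a : ℝ, A < a → ∀ ψ : E2 → E2, MemH1 ψ → ψ ≠ 0 →
      (∫ x : E2, μa a x * ‖ψ x‖^2) < ε^2 * ∫ x : E2, gradSq ψ x := by
  obtain ⟨M, hM⟩ := hμ.bdd
  have hanti : StrictAntiOn μrad (Ici 0) := by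
    refine strictAntiOn_of_deriv_neg (convex_Ici 0) hμ.smooth_rad.continuous.continuousOn ?_
    intro r hr
    rw [interior_Ici] at hr
    exact hμ.deriv_neg r hr
  set R := ρ + 1 with hR
  have hρ := hμ.rho_pos
  set δ := -μrad R with hδdef
  have hδ : 0 < δ := by
    have := hanti (show ρ ∈ Ici (0:ℝ) from hρ.le) (show R ∈ Ici (0:ℝ) by simp [hR]; linarith)
      (by linarith)
    rw [hμ.rho_root] at this
    linarith
  set As : ℝ → Set E2 := fun a => {x | 0 < a ∧ x ∈ Metric.closedBall (0 : E2) R ∧ -δ < μa a x}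
    with hAs
  have hAsm : ∀ a, MeasurableSet (As a) := by
    intro a
    by_cases ha : 0 < a
    · have : As a = Metric.closedBall (0 : E2) R ∩ {x | -δ < μa a x} := by
        ext x; simp [hAs, ha]
      rw [this]
      exact Metric.isClosed_closedBall.measurableSet.inter
        (measurableSet_lt measurable_const (hmeas a ha))
    · have : As a = ∅ := by ext x; simp [hAs, ha]
      rw [this]; exact MeasurableSet.empty
  have hsub : ∀ a, As a ⊆ Metric.closedBall (0 : E2) R := fun a x hx => hx.2.1
  have htend : Tendsto (fun a => (volume : Measure E2) (As a)) atTop (𝓝 0) := by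
    have h := tendsto_measure_of_ae_tendsto_indicator (μ := (volume : Measure E2)) atTop
      (A := (∅ : Set E2)) (As := As) MeasurableSet.empty hAsm
      (B := Metric.closedBall (0 : E2) R) Metric.isClosed_closedBall.measurableSet
      measure_closedBall_lt_top.ne (Eventually.of_forall hsub) ?_
    · simpa using h
    · filter_upwards [hlim] with x hx
      filter_upwards [hx.eventually (eventually_le_atBot (-δ))] with a ha
      simp only [mem_empty_iff_false, iff_false]
      intro h
      exact absurd h.2.2 (not_lt.mpr ha)
  set L := M + δ with hL
  have hη : 0 < δ * ε ^ 2 / (L ^ 2 + 1) := by positivity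
  obtain ⟨A, hA⟩ := (htend.eventually
    (gt_mem_nhds (ENNReal.ofReal_pos.mpr hη))).exists_forall_of_atTop
  refine ⟨max A 1, by positivity, fun a ha ψ hψ hne => ?_⟩
  have ha0 : 0 < a := lt_trans zero_lt_one ((le_max_right _ _).trans_lt ha)
  have hmA := hA a ((le_max_left _ _).trans ha.le)
  obtain ⟨hdiff, hL2, hgL2⟩ := hψ
  have hψm : Measurable ψ := hdiff.continuous.measurable
  have hint : Integrable fun x => ‖ψ x‖ ^ 2 := hL2.integrable_norm_pow (by norm_num)
  have hm : ∀ i, Measurable fun x => fderiv ℝ ψ x (e2basis i) :=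
    fun i => measurable_fderiv_apply_const ℝ ψ _
  have hg0 : ∀ x, 0 ≤ gradSq ψ x := fun x => Finset.sum_nonneg fun i _ => by positivity
  have hgint : Integrable fun x => gradSq ψ x := by
    unfold gradSq
    refine integrable_finsetSum _ fun i _ => ?_
    have hb : Integrable fun x => ‖fderiv ℝ ψ x‖ ^ 2 := hgL2.integrable_norm_pow (by norm_num)
    refine hb.mono' ((hm i).norm.pow_const 2).aestronglyMeasurable
      (Eventually.of_forall fun x => ?_)
    rw [Real.norm_of_nonneg (by positivity)]
    have h1 := (fderiv ℝ ψ x).le_opNorm (e2basis i)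
    have h2 : ‖e2basis i‖ = 1 := by simp [e2basis]
    rw [h2, mul_one] at h1
    gcongr
  set p := ∫ x, ‖ψ x‖ ^ 2 with hp
  set d := ∫ x, gradSq ψ x with hd
  have hP : ∫⁻ x, ‖ψ x‖ₑ ^ 2 = ENNReal.ofReal p := by
    simp only [enorm_sq']
    exact (ofReal_integral_eq_lintegral_ofReal hint
      (Eventually.of_forall fun x => by positivity)).symm
  have hD : ∫⁻ x, ENNReal.ofReal (gradSq ψ x) = ENNReal.ofReal d :=
    (ofReal_integral_eq_lintegral_ofReal hgint (Eventually.of_forall hg0)).symm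
  have hd0 : 0 ≤ d := integral_nonneg hg0
  have hp0 : 0 ≤ p := integral_nonneg fun x => by positivity
  have hlad := ladyz2 ψ hdiff (by rw [hP]; exact ENNReal.ofReal_ne_top)
  rw [hP, hD, ← ENNReal.ofReal_mul hp0] at hlad
  -- a function vanishing a.e. vanishes
  have hae : ¬ (ψ =ᵐ[volume] 0) := fun h =>
    hne ((Continuous.ae_eq_iff_eq volume hdiff.continuous continuous_zero).mp h)
  have hpd : 0 < p * d := by
    by_contra hcon
    rw [ENNReal.ofReal_of_nonpos (not_lt.mp hcon), mul_zero, nonpos_iff_eq_zero,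
      lintegral_eq_zero_iff (hψm.enorm.pow_const 4)] at hlad
    apply hae
    filter_upwards [hlad] with x hx
    simpa using hx
  have hppos : 0 < p := pos_of_mul_pos_left hpd hd0
  have hdpos : 0 < d := pos_of_mul_pos_right hpd hp0
  by_cases hi : Integrable fun x => μa a x * ‖ψ x‖ ^ 2
  swap
  · rw [integral_undef hi]; positivity
  set S := As a with hS
  have hSm : MeasurableSet S := hAsm a
  have hSfin : volume S ≠ ∞ := (hmA.trans ENNReal.ofReal_lt_top).ne
  set m := (volume S).toReal with hmdef
  set j := ∫ x in S, ‖ψ x‖ ^ 2 with hj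
  have hj0 : 0 ≤ j := integral_nonneg fun x => by positivity
  have hJ : ∫⁻ x in S, ‖ψ x‖ₑ ^ 2 = ENNReal.ofReal j := by
    simp only [enorm_sq']
    exact (ofReal_integral_eq_lintegral_ofReal hint.integrableOn
      (Eventually.of_forall fun x => by positivity)).symm
  have hj2 : j ^ 2 ≤ 4 * (m * (p * d)) := by
    have h := cs_sq (volume.restrict S) (fun _ => 1) (fun x => ‖ψ x‖ₑ ^ 2)
      aemeasurable_const (hψm.enorm.pow_const 2).aemeasurable
    simp only [one_mul, one_pow, lintegral_const, Measure.restrict_apply_univ, ← pow_mul] at h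
    rw [hJ] at h
    have h' : ENNReal.ofReal j ^ 2 ≤ volume S * (4 * ENNReal.ofReal (p * d)) :=
      h.trans (mul_le_mul' le_rfl ((setLIntegral_le_lintegral _ _).trans hlad))
    have h4 : (4 : ℝ≥0∞) = ENNReal.ofReal 4 := by simp
    rw [← ENNReal.ofReal_toReal hSfin, h4, ← ENNReal.ofReal_mul (by norm_num),
      ← ENNReal.ofReal_mul ENNReal.toReal_nonneg, ← ENNReal.ofReal_pow hj0,
      ENNReal.ofReal_le_ofReal_iff (mul_nonneg ENNReal.toReal_nonneg (by positivity))] at h'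
    linarith
  have hmL : L ^ 2 * m < δ * ε ^ 2 := by
    have h1 : m < δ * ε ^ 2 / (L ^ 2 + 1) := by
      have := (ENNReal.toReal_lt_toReal hSfin ENNReal.ofReal_ne_top).mpr hmA
      rwa [ENNReal.toReal_ofReal hη.le] at this
    rw [lt_div_iff₀ (by positivity)] at h1
    have : 0 ≤ m := ENNReal.toReal_nonneg
    nlinarith
  refine lt_of_le_of_lt ?_ (final_ineq L δ ε j m p d hδ hε hppos hd0 hj2 hmL)
  have hind : Integrable (S.indicator fun x => ‖ψ x‖ ^ 2) := hint.indicator hSm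
  have hrhs : L * j - δ * p = ∫ x, (L * S.indicator (fun x => ‖ψ x‖ ^ 2) x - δ * ‖ψ x‖ ^ 2) := by
    rw [integral_sub (hind.const_mul L) (hint.const_mul δ), integral_const_mul,
      integral_const_mul, integral_indicator hSm]
  rw [hrhs]
  refine integral_mono hi ((hind.const_mul L).sub (hint.const_mul δ)) fun x => ?_
  have hsq : 0 ≤ ‖ψ x‖ ^ 2 := by positivity
  by_cases hx : x ∈ S
  · simp only [indicator_of_mem hx]
    have := mul_le_mul_of_nonneg_right ((hle a ha0 x).trans ((le_abs_self _).trans (hM x))) hsq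
    rw [hL]; linarith
  · simp only [indicator_of_notMem hx]
    have h1 : μa a x ≤ -δ := by
      by_cases hb : x ∈ Metric.closedBall (0 : E2) R
      · by_contra hcon
        exact hx ⟨ha0, hb, not_le.mp hcon⟩
      · have hb' : R < ‖x‖ := by simpa using hb
        have := hanti (show R ∈ Ici (0:ℝ) by simp [hR]; linarith)
          (show ‖x‖ ∈ Ici (0:ℝ) from norm_nonneg x) hb'
        have h2 := hle a ha0 x
        rw [hμ.radial] at h2
        linarith
    have := mul_le_mul_of_nonneg_right h1 hsq
    linarith
end
end
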